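/- For every σ-finite Borel measure μ on [0,∞) with μ([0,t]) < ∞ for all t ≥ 0, the nonlinear Volterra equation V(t) = ∫_{[0,t]} W′(t−s) μ(ds) − ∫₀^t (𝓡∘V)(s)·W′(t−s) ds, t ≥ 0, has a unique global solution V_μ in the space of nonnegative càdlàg functions on [0,∞); moreover 0 ≤ V_μ(t) ≤ μ([0,t])/c for all t ≥ 0. -/

import Mathlib

open MeasureTheory Real Set Filter Topology

noncomputable def tailNu (ν : Measure ℝ) (y : ℝ) : ℝ := (ν (Set.Ici y)).toReal

noncomputable def itailNu (ν : Measure ℝ) (x : ℝ) : ℝ := ∫ y in Set.Ioi x, tailNu ν y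

noncomputable def phi (b c : ℝ) (ν : Measure ℝ) (l : ℝ) : ℝ :=
  b * l + c * l ^ 2 + ∫ y in Set.Ioi (0 : ℝ), (Real.exp (-l * y) - 1 + l * y) ∂ν

/-- The nonlinear operator `𝓡`. -/
noncomputable def Rop (c : ℝ) (ν : Measure ℝ) (f : ℝ → ℝ) (t : ℝ) : ℝ :=
  c * f t ^ 2 + ∫ y in Set.Ioi (0 : ℝ),
    (Real.exp (-(∫ r in (max (t - y) 0)..t, f r)) - 1 + ∫ r in (max (t - y) 0)..t, f r) ∂ν

/-- Nonnegative on `[0,∞)` and càdlàg there: right-continuous at every `t ≥ 0` and with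
left limits at every `t > 0`. -/
def CadlagNonneg (V : ℝ → ℝ) : Prop :=
  (∀ t : ℝ, 0 ≤ t → 0 ≤ V t) ∧
  (∀ t : ℝ, 0 ≤ t → ContinuousWithinAt V (Set.Ici t) t) ∧
  (∀ t : ℝ, 0 < t → ∃ l : ℝ, Filter.Tendsto V (nhdsWithin t (Set.Iio t)) (nhds l))

/-- The right-hand side of the nonlinear Volterra equation
`V(t) = ∫_{[0,t]} W′(t−s) μ(ds) − ∫₀^t (𝓡∘V)(s)·W′(t−s) ds`. -/
noncomputable def volterraRHS (c : ℝ) (ν μ : Measure ℝ) (W' V : ℝ → ℝ) (t : ℝ) : ℝ :=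
  (∫ s in Set.Icc (0 : ℝ) t, W' (t - s) ∂μ) -
    ∫ s in (0 : ℝ)..t, Rop c ν V s * W' (t - s)

open scoped ENNReal

lemma conv_wd (m : Measure ℝ) [SFinite m] (k : ℝ → ℝ≥0∞) (hk : Measurable k) :
    (volume.withDensity k).conv m = volume.withDensity (fun t => ∫⁻ s, k (t - s) ∂m) := by
  refine Measure.ext_of_lintegral _ fun f hf => ?_
  rw [Measure.conv_comm, Measure.lintegral_conv hf]
  rw [lintegral_withDensity_eq_lintegral_mul _ (by
    exact Measurable.lintegral_prod_right' (f := fun p : ℝ × ℝ => k (p.1 - p.2)) (by fun_prop)) hf]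
  have : ∀ x : ℝ, ∫⁻ y, f (x + y) ∂(volume.withDensity k) = ∫⁻ t, k (t - x) * f t := by
    intro x
    rw [lintegral_withDensity_eq_lintegral_mul _ hk (by fun_prop)]
    rw [← lintegral_add_right_eq_self (fun t => k (t - x) * f t) x]
    simp [add_comm]
  simp_rw [this]
  rw [lintegral_lintegral_swap (by fun_prop)]
  refine lintegral_congr fun t => ?_
  simp only [Pi.mul_apply]
  rw [lintegral_mul_const _ (by fun_prop)]

lemma rc_upgrade {β : Type*} [TopologicalSpace β] [T2Space β] (f g : ℝ → β)
    (h : ∀ᵐ t ∂(volume : Measure ℝ), 0 ≤ t → f t = g t) (t : ℝ) (ht : 0 ≤ t)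
    (hf : ContinuousWithinAt f (Ici t) t) (hg : ContinuousWithinAt g (Ici t) t) : f t = g t := by
  have hfr : ∃ᶠ x in 𝓝[>] t, f x = g x := by
    have h2 : ∃ᶠ x in 𝓝[>] t, x ∈ {x | 0 ≤ x → f x = g x} := by
      have hd : Dense {x | 0 ≤ x → f x = g x} := Measure.dense_of_ae h
      rw [frequently_nhdsWithin_iff, frequently_iff]
      intro V hV
      obtain ⟨e, he, hb⟩ := Metric.mem_nhds_iff.1 hV
      obtain ⟨x, hx, hx2⟩ := hd.exists_between (show t < t + e by linarith)
      exact ⟨x, hb (by rw [Metric.mem_ball, Real.dist_eq, abs_lt]; constructor <;> linarith [hx2.1, hx2.2]), hx, hx2.1⟩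
    refine (h2.and_eventually self_mem_nhdsWithin).mono ?_
    rintro x ⟨h1, h3⟩
    exact h1 (ht.trans (le_of_lt h3))
  exact tendsto_nhds_unique_of_frequently_eq (hf.mono_left (nhdsWithin_mono _ Ioi_subset_Ici_self))
    (hg.mono_left (nhdsWithin_mono _ Ioi_subset_Ici_self)) hfr

lemma Iic_rc (A : Measure ℝ) (hA : ∀ t, A (Iic t) ≠ ⊤) (t : ℝ) :
    ContinuousWithinAt (fun t => A (Iic t)) (Ici t) t := by
  have h1 : Tendsto (fun t => A (Iic t)) (𝓝[>] t) (𝓝 (A (Iic t))) := by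
    have := tendsto_measure_biInter_gt (μ := A) (s := fun x => Iic x) (a := t)
      (fun r _ => measurableSet_Iic.nullMeasurableSet) (fun i j _ hij => Iic_subset_Iic.2 hij)
      ⟨t+1, by simp, hA _⟩
    have hE : Iic t = ⋂ r > t, Iic r := by
      ext x
      simp only [mem_iInter, mem_Iic]
      exact ⟨fun h r hr => h.trans (le_of_lt hr), fun h => le_of_forall_gt_imp_ge_of_dense h⟩
    rw [← hE] at this
    exact this
  exact (continuousWithinAt_Ioi_iff_Ici (f := fun t => A (Iic t)) (a := t)).1 h1

noncomputable def ell : Measure ℝ := volume.withDensity ((Ici (0:ℝ)).indicator 1)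

instance : SFinite ell := by unfold ell; infer_instance

lemma ell_conv (A : Measure ℝ) [SFinite A] : ell.conv A = volume.withDensity (fun t => A (Iic t)) := by
  unfold ell
  rw [conv_wd _ _ (measurable_one.indicator measurableSet_Ici)]
  congr 1
  ext t
  have : (fun s => (Ici (0:ℝ)).indicator (1 : ℝ → ℝ≥0∞) (t - s)) = (Iic t).indicator 1 := by
    ext s; simp [indicator]
  rw [this, lintegral_indicator measurableSet_Iic]; simp

lemma ae_of_wd_eq (f g : ℝ → ℝ≥0∞) (hf : Measurable f) (hg : Measurable g)
    (h : volume.withDensity f = volume.withDensity g) : ∀ᵐ t ∂(volume : Measure ℝ), f t = g t :=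
  (withDensity_eq_iff_of_sigmaFinite hf.aemeasurable hg.aemeasurable).1 h

lemma ell_cancel (A B : Measure ℝ) [SFinite A] [SFinite B] (hA : ∀ t, A (Iic t) ≠ ⊤)
    (hA0 : A (Iio 0) = 0) (hB0 : B (Iio 0) = 0)
    (h : ell.conv A = ell.conv B) : A = B := by
  rw [ell_conv, ell_conv] at h
  have mA : ∀ A : Measure ℝ, Measurable fun t => A (Iic t) := fun A =>
    Monotone.measurable fun a b hab => measure_mono (Iic_subset_Iic.2 hab)
  have h2 := ae_of_wd_eq _ _ (mA A) (mA B) h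
  have hB : ∀ t, B (Iic t) ≠ ⊤ := by
    intro t
    obtain ⟨x, hx, hx2⟩ := (Measure.dense_of_ae h2).exists_between (show t < t + 1 by linarith)
    have hx : A (Iic x) = B (Iic x) := hx
    exact ((measure_mono (Iic_subset_Iic.2 hx2.1.le)).trans_lt (hx ▸ (hA x).lt_top)).ne
  have h3 : ∀ t, A (Iic t) = B (Iic t) := by
    intro t
    by_cases ht : 0 ≤ t
    · exact rc_upgrade (fun t => A (Iic t)) (fun t => B (Iic t)) (h2.mono fun t h _ => h) t ht (Iic_rc A hA t) (Iic_rc B hB t)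
    · have : Iic t ⊆ Iio 0 := fun x hx => lt_of_le_of_lt hx (not_le.1 ht)
      rw [measure_mono_null this hA0, measure_mono_null this hB0]
  refine Measure.ext_of_Ioc' A B (fun a b _ => ((measure_mono Ioc_subset_Iic_self).trans_lt (hA b).lt_top).ne) ?_
  intro a b hab
  rw [← Iic_sdiff_Iic, measure_sdiff (Iic_subset_Iic.2 hab.le) nullMeasurableSet_Iic (hA a),
    measure_sdiff (Iic_subset_Iic.2 hab.le) nullMeasurableSet_Iic (hB a), h3, h3]

lemma laplace_unique (A B : Measure ℝ)
    (hA : ∀ l : ℝ, 0 < l → ∫⁻ x, ENNReal.ofReal (Real.exp (-l * x)) ∂A ≠ ⊤)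
    (h : ∀ l : ℝ, 0 < l → ∫⁻ x, ENNReal.ofReal (Real.exp (-l * x)) ∂A =
      ∫⁻ x, ENNReal.ofReal (Real.exp (-l * x)) ∂B) : A = B := by
  set e : ℝ → ℝ≥0∞ := fun x => ENNReal.ofReal (Real.exp (-x)) with he
  have hem : Measurable e := by fun_prop
  have key : ∀ A : Measure ℝ, ∀ t : ℝ, ∫⁻ x, ENNReal.ofReal (Real.exp (t * x)) ∂(A.withDensity e) =
      ∫⁻ x, ENNReal.ofReal (Real.exp (-(1 - t) * x)) ∂A := by
    intro A t
    rw [lintegral_withDensity_eq_lintegral_mul _ hem (by fun_prop)]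
    refine lintegral_congr fun x => ?_
    simp only [he, Pi.mul_apply]
    rw [← ENNReal.ofReal_mul (by positivity), ← Real.exp_add]; congr 2; ring
  have hB : ∀ l : ℝ, 0 < l → ∫⁻ x, ENNReal.ofReal (Real.exp (-l * x)) ∂B ≠ ⊤ := fun l hl => h l hl ▸ hA l hl
  have int : ∀ A : Measure ℝ, (∀ l : ℝ, 0 < l → ∫⁻ x, ENNReal.ofReal (Real.exp (-l * x)) ∂A ≠ ⊤) →
      ∀ t < 1, Integrable (fun x => Real.exp (t * x)) (A.withDensity e) := by
    intro A hA t ht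
    rw [← lintegral_ofReal_ne_top_iff_integrable (by fun_prop) (ae_of_all _ fun x => by positivity), key]
    exact hA _ (by linarith)
  have fin : ∀ A : Measure ℝ, (∀ l : ℝ, 0 < l → ∫⁻ x, ENNReal.ofReal (Real.exp (-l * x)) ∂A ≠ ⊤) →
      IsFiniteMeasure (A.withDensity e) := by
    intro A hA
    refine ⟨?_⟩
    have := key A 0
    simp only [zero_mul, Real.exp_zero, ENNReal.ofReal_one, lintegral_one] at this
    rw [this]; exact (hA _ (by norm_num)).lt_top
  have := fin A hA
  have := fin B hB
  have mem : ∀ A : Measure ℝ, (∀ l : ℝ, 0 < l → ∫⁻ x, ENNReal.ofReal (Real.exp (-l * x)) ∂A ≠ ⊤) →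
     ∀ t < 1, t ∈ interior (ProbabilityTheory.integrableExpSet id (A.withDensity e)) := by
    intro A hA t ht
    refine mem_interior.2 ⟨Iio 1, fun t ht => int A hA t ht, isOpen_Iio, ht⟩
  have mg : ∀ t < 1, ProbabilityTheory.mgf id (A.withDensity e) t = ProbabilityTheory.mgf id (B.withDensity e) t := by
    intro t ht
    simp only [ProbabilityTheory.mgf, id]
    rw [integral_eq_lintegral_of_nonneg_ae (ae_of_all _ fun x => by positivity) (by fun_prop),
      integral_eq_lintegral_of_nonneg_ae (ae_of_all _ fun x => by positivity) (by fun_prop), key, key, h _ (by linarith)]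
  have cE : Set.EqOn (ProbabilityTheory.complexMGF id (A.withDensity e)) (ProbabilityTheory.complexMGF id (B.withDensity e)) {z | z.re < 1} := by
    have hX : AnalyticOnNhd ℂ (ProbabilityTheory.complexMGF id (A.withDensity e)) {z | z.re < 1} :=
      ProbabilityTheory.analyticOnNhd_complexMGF.mono fun z hz => mem A hA _ hz
    have hY : AnalyticOnNhd ℂ (ProbabilityTheory.complexMGF id (B.withDensity e)) {z | z.re < 1} :=
      ProbabilityTheory.analyticOnNhd_complexMGF.mono fun z hz => mem B hB _ hz
    refine AnalyticOnNhd.eqOn_of_preconnected_of_frequently_eq hX hY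
      (convex_halfSpace_re_lt 1).isPreconnected (z₀ := ((0:ℝ) : ℂ)) (by simp) ?_
    have h_real : ∃ᶠ (x : ℝ) in 𝓝[≠] 0, ProbabilityTheory.complexMGF id (A.withDensity e) x = ProbabilityTheory.complexMGF id (B.withDensity e) x := by
      refine Eventually.frequently ?_
      filter_upwards [nhdsWithin_le_nhds (Iio_mem_nhds (show (0:ℝ) < 1 by norm_num))] with x hx
      rw [ProbabilityTheory.complexMGF_ofReal, ProbabilityTheory.complexMGF_ofReal, mg x hx]
    rw [frequently_iff_seq_forall] at h_real ⊢
    obtain ⟨xs, hx_tendsto, hx_eq⟩ := h_real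
    refine ⟨fun n ↦ xs n, ?_, fun n ↦ ?_⟩
    · rw [tendsto_nhdsWithin_iff] at hx_tendsto ⊢
      constructor
      · exact (Complex.continuous_ofReal.tendsto 0).comp hx_tendsto.1
      · simpa using hx_tendsto.2
    · simp [hx_eq]
  have hAB : A.withDensity e = B.withDensity e := by
    apply Measure.ext_of_charFun
    ext t
    rw [← ProbabilityTheory.complexMGF_id_mul_I, ← ProbabilityTheory.complexMGF_id_mul_I]
    exact cE (by simp)
  have e0 : ∀ x, e x ≠ 0 := fun x => by simp [he, Real.exp_pos]
  have r : ∀ A : Measure ℝ, (A.withDensity e).withDensity (e⁻¹) = A := fun A =>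
    withDensity_inv_same hem (ae_of_all _ e0) (ae_of_all _ fun x => by simp [he])
  rw [← r A, ← r B, hAB]

noncomputable def ph (x : ℝ) : ℝ := Real.exp (-x) - 1 + x

lemma ph_nonneg (x : ℝ) : 0 ≤ ph x := by
  unfold ph; linarith [Real.add_one_le_exp (-x)]

lemma ph_meas : Measurable ph := by unfold ph; fun_prop

lemma ph_diff (a b M : ℝ) (ha : 0 ≤ a) (hb : 0 ≤ b) (haM : a ≤ M) (hbM : b ≤ M) :
    |ph a - ph b| ≤ min 1 M * |a - b| := by
  have hder : ∀ x ∈ Icc 0 M, HasDerivWithinAt ph (1 - Real.exp (-x)) (Icc 0 M) x := by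
    intro x _
    have : HasDerivAt ph (Real.exp (-x) * (-1) - 0 + 1) x :=
      (((hasDerivAt_neg x).exp).sub (hasDerivAt_const x 1)).add (hasDerivAt_id x)
    have h2 : 1 - Real.exp (-x) = Real.exp (-x) * (-1) - 0 + 1 := by ring
    rw [h2]
    exact this.hasDerivWithinAt
  have := (convex_Icc 0 M).norm_image_sub_le_of_norm_hasDerivWithin_le (C := min 1 M) hder ?_
    (x := b) (y := a) ⟨hb, hbM⟩ ⟨ha, haM⟩
  · simpa [Real.norm_eq_abs] using this
  · intro x hx
    rw [Real.norm_eq_abs, abs_of_nonneg (by linarith [Real.exp_le_one_iff.2 (show -x ≤ 0 by linarith [hx.1])])]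
    refine le_min (by linarith [Real.exp_pos (-x)]) ?_
    linarith [Real.add_one_le_exp (-x), hx.2]

lemma ph_le (a M : ℝ) (ha : 0 ≤ a) (haM : a ≤ M) : ph a ≤ min 1 M * M := by
  have := ph_diff a 0 M ha le_rfl haM (ha.trans haM)
  have h0 : ph 0 = 0 := by simp [ph]
  rw [h0, sub_zero, sub_zero, abs_of_nonneg (ph_nonneg a), abs_of_nonneg ha] at this
  exact this.trans (mul_le_mul_of_nonneg_left haM (le_min zero_le_one (ha.trans haM)))

lemma min_scale (M y : ℝ) (hM : 1 ≤ M) (hy : 0 < y) : min 1 (M * y) * y ≤ M * min y (y ^ 2) := by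
  rcases le_total y (y^2) with h | h
  · rw [min_eq_left h]
    exact mul_le_mul_of_nonneg_right ((min_le_left _ _).trans hM) hy.le
  · rw [min_eq_right h]
    calc _ ≤ (M * y) * y := mul_le_mul_of_nonneg_right (min_le_right _ _) hy.le
      _ = _ := by ring


lemma nu_sfin (ν : Measure ℝ) (hν : ∫⁻ y in Set.Ioi (0 : ℝ), ENNReal.ofReal (min y (y ^ 2)) ∂ν ≠ ⊤) : SFinite (ν.restrict (Ioi 0)) := by
  set d : ℝ → ℝ≥0∞ := fun y => ENNReal.ofReal (min y (y ^ 2))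
  have hd : Measurable d := by fun_prop
  have h0 : ∀ᵐ y ∂(ν.restrict (Ioi 0)), d y ≠ 0 := by
    filter_upwards [ae_restrict_mem measurableSet_Ioi] with y hy
    have hy : 0 < y := hy
    simp only [d, ne_eq, ENNReal.ofReal_eq_zero, not_le]
    positivity
  have hf : IsFiniteMeasure ((ν.restrict (Ioi 0)).withDensity d) := isFiniteMeasure_withDensity hν
  rw [← withDensity_inv_same hd h0 (ae_of_all _ fun y => by simp [d])]
  infer_instance

lemma nu_int (ν : Measure ℝ) (hν : ∫⁻ y in Set.Ioi (0 : ℝ), ENNReal.ofReal (min y (y ^ 2)) ∂ν ≠ ⊤) : Integrable (fun y => min y (y ^ 2)) (ν.restrict (Ioi 0)) := by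
  rw [← lintegral_ofReal_ne_top_iff_integrable (by fun_prop) ?_]
  · exact hν
  · filter_upwards [ae_restrict_mem measurableSet_Ioi] with y hy
    have hy : 0 < y := hy
    simp only [Pi.zero_apply]
    positivity

/-- integrability of `ph ∘ a` for linearly bounded `a` -/
lemma nu_ph_int (ν : Measure ℝ) (hν : ∫⁻ y in Set.Ioi (0 : ℝ), ENNReal.ofReal (min y (y ^ 2)) ∂ν ≠ ⊤) (a : ℝ → ℝ) (hm : Measurable a) (M : ℝ) (hM : 1 ≤ M)
    (h : ∀ y, 0 < y → 0 ≤ a y ∧ a y ≤ M * y) :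
    Integrable (fun y => ph (a y)) (ν.restrict (Ioi 0)) := by
  refine Integrable.mono' ((nu_int ν hν).const_mul (M*M)) (ph_meas.comp hm).aestronglyMeasurable ?_
  filter_upwards [ae_restrict_mem measurableSet_Ioi] with y hy
  have hy : 0 < y := hy
  rw [Real.norm_eq_abs, abs_of_nonneg (ph_nonneg _)]
  refine (ph_le _ _ (h y hy).1 (h y hy).2).trans ?_
  have := mul_le_mul_of_nonneg_left (min_scale M y hM hy) (zero_le_one.trans hM)
  linarith

noncomputable def kap (b : ℝ) (ν : Measure ℝ) : ℝ → ℝ≥0∞ :=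
  (Ici (0:ℝ)).indicator (fun x => ENNReal.ofReal b + ∫⁻ y in Ioi (0:ℝ), ENNReal.ofReal (y - x) ∂ν)

lemma kap_meas (b : ℝ) (ν : Measure ℝ) (h : SFinite (ν.restrict (Ioi 0))) : Measurable (kap b ν) := by
  refine Measurable.indicator ?_ measurableSet_Ici
  have hm : Measurable fun x => ∫⁻ y in Ioi (0:ℝ), ENNReal.ofReal (y - x) ∂ν :=
    Measurable.lintegral_prod_right' (f := fun p : ℝ × ℝ => ENNReal.ofReal (p.2 - p.1)) (by fun_prop)
  exact Measurable.add measurable_const hm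

noncomputable def Jm (b c : ℝ) (ν : Measure ℝ) : Measure ℝ :=
  ENNReal.ofReal c • Measure.dirac 0 + volume.withDensity (kap b ν)

instance (b c : ℝ) (ν : Measure ℝ) : SFinite (Jm b c ν) := by unfold Jm; infer_instance

noncomputable def lap (A : Measure ℝ) (l : ℝ) : ℝ≥0∞ := ∫⁻ x, ENNReal.ofReal (Real.exp (-l * x)) ∂A

lemma lap_conv (A B : Measure ℝ) [SFinite A] [SFinite B] (l : ℝ) : lap (A.conv B) l = lap A l * lap B l := by
  unfold lap
  rw [Measure.lintegral_conv (by fun_prop), ← lintegral_mul_const _ (by fun_prop)]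
  refine lintegral_congr fun x => ?_
  rw [← lintegral_const_mul _ (by fun_prop)]
  refine lintegral_congr fun y => ?_
  rw [← ENNReal.ofReal_mul (by positivity), ← Real.exp_add]; congr 2; ring

lemma lap_wd (f : ℝ → ℝ≥0∞) (hf : Measurable f) (l : ℝ) :
    lap (volume.withDensity ((Ici 0).indicator f)) l = ∫⁻ x in Ioi 0, ENNReal.ofReal (Real.exp (-l * x)) * f x := by
  unfold lap
  rw [lintegral_withDensity_eq_lintegral_mul _ (hf.indicator measurableSet_Ici) (by fun_prop)]
  rw [setLIntegral_congr Ioi_ae_eq_Ici, ← lintegral_indicator measurableSet_Ici]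
  refine lintegral_congr fun x => ?_
  by_cases hx : x ∈ Ici (0:ℝ) <;> simp [hx, mul_comm]

lemma lap_one (l : ℝ) (hl : 0 < l) : ∫⁻ x in Ioi (0:ℝ), ENNReal.ofReal (Real.exp (-l * x)) = ENNReal.ofReal (1 / l) := by
  rw [← ofReal_integral_eq_lintegral_ofReal (integrableOn_exp_mul_Ioi (by linarith) 0) (ae_of_all _ fun x => by positivity)]
  rw [integral_exp_mul_Ioi (by linarith)]
  simp

lemma lap_ell (l : ℝ) (hl : 0 < l) : lap ell l = ENNReal.ofReal (1 / l) := by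
  unfold ell
  rw [lap_wd _ measurable_one, ← lap_one l hl]; simp

lemma lap_tri (l y : ℝ) (hl : 0 < l) (hy : 0 < y) :
    ∫⁻ x in Ioi (0:ℝ), ENNReal.ofReal (Real.exp (-l * x)) * ENNReal.ofReal (y - x) = ENNReal.ofReal (ph (l * y) / l ^ 2) := by
  have h1 : ∫ x in (0:ℝ)..y, Real.exp (-l * x) * (y - x) = ph (l * y) / l ^ 2 := by
    rw [intervalIntegral.integral_eq_sub_of_hasDerivAt (f := fun x => -(Real.exp (-l * x) * (y - x)) / l + Real.exp (-l * x) / l ^ 2)]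
    · simp only [ph]; field_simp; simp; ring_nf
    · intro x _
      have e : HasDerivAt (fun x => Real.exp (-l * x)) (Real.exp (-l * x) * (-l * 1)) x :=
        ((hasDerivAt_id x).const_mul (-l)).exp
      have := ((e.mul ((hasDerivAt_const x y).sub (hasDerivAt_id x))).neg.div_const l).add (e.div_const (l^2))
      have h2 : -(rexp (-l * x) * (-l * 1) * (y - x) + rexp (-l * x) * (0 - 1)) / l +
        rexp (-l * x) * (-l * 1) / l ^ 2 = rexp (-l * x) * (y - x) := by
        field_simp; ring
      rw [← h2]
      exact this
    · exact Continuous.intervalIntegrable (by fun_prop) _ _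
  rw [← h1, intervalIntegral.integral_of_le hy.le, ofReal_integral_eq_lintegral_ofReal]
  · rw [← Ioc_union_Ioi_eq_Ioi hy.le, lintegral_union measurableSet_Ioi (by
      rw [disjoint_left]; intro x hx hx2; exact absurd hx.2 (not_le.2 hx2))]
    rw [setLIntegral_congr_fun (g := fun _ => 0) measurableSet_Ioi (fun x hx => by
      have hx : y < x := hx
      simp [ENNReal.ofReal_of_nonpos (show y - x ≤ 0 by linarith)])]
    simp only [lintegral_zero, add_zero]
    refine lintegral_congr fun x => ?_
    rw [ENNReal.ofReal_mul (by positivity)]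
  · exact (Continuous.integrableOn_Ioc (by fun_prop))
  · filter_upwards [ae_restrict_mem measurableSet_Ioc] with x hx
    simp only [Pi.zero_apply]
    have := hx.2
    exact mul_nonneg (by positivity) (by linarith)

lemma phi_eq (b c : ℝ) (ν : Measure ℝ) (l : ℝ) : phi b c ν l = b * l + c * l ^ 2 + ∫ y in Ioi (0:ℝ), ph (l * y) ∂ν := by
  simp [phi, ph]

lemma phi_pos (b c : ℝ) (hb : 0 ≤ b) (hc : 0 < c) (ν : Measure ℝ) (l : ℝ) (hl : 0 < l) : 0 < phi b c ν l := by
  rw [phi_eq]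
  have : 0 ≤ ∫ y in Ioi (0:ℝ), ph (l * y) ∂ν := integral_nonneg fun y => ph_nonneg _
  positivity

lemma lap_J (b c : ℝ) (hb : 0 ≤ b) (hc : 0 < c) (ν : Measure ℝ)
    (hν : ∫⁻ y in Set.Ioi (0 : ℝ), ENNReal.ofReal (min y (y ^ 2)) ∂ν ≠ ⊤) (l : ℝ) (hl : 0 < l) :
    lap (Jm b c ν) l = ENNReal.ofReal (phi b c ν l / l ^ 2) := by
  have hs := nu_sfin ν hν
  have hm : Measurable fun x => ∫⁻ y in Ioi (0:ℝ), ENNReal.ofReal (y - x) ∂ν :=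
    Measurable.lintegral_prod_right' (f := fun p : ℝ × ℝ => ENNReal.ofReal (p.2 - p.1)) (by fun_prop)
  have h1 : lap (volume.withDensity (kap b ν)) l = ENNReal.ofReal (b / l) + ENNReal.ofReal ((∫ y in Ioi (0:ℝ), ph (l * y) ∂ν) / l ^ 2) := by
    unfold kap
    rw [lap_wd (fun x => ENNReal.ofReal b + ∫⁻ y in Ioi (0:ℝ), ENNReal.ofReal (y - x) ∂ν) (Measurable.add measurable_const hm)]
    simp_rw [mul_add]
    rw [lintegral_add_left (by fun_prop), lintegral_mul_const _ (by fun_prop), lap_one l hl]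
    congr 1
    · rw [← ENNReal.ofReal_mul (by positivity)]; congr 1; ring
    · have h3 : ∀ x : ℝ, ENNReal.ofReal (rexp (-l * x)) * ∫⁻ y in Ioi (0:ℝ), ENNReal.ofReal (y - x) ∂ν =
          ∫⁻ y in Ioi (0:ℝ), ENNReal.ofReal (rexp (-l * x)) * ENNReal.ofReal (y - x) ∂ν := fun x => by
        rw [lintegral_const_mul _ (by fun_prop)]
      simp_rw [h3]
      rw [lintegral_lintegral_swap (by fun_prop)]
      rw [setLIntegral_congr_fun measurableSet_Ioi (fun y hy => lap_tri l y hl hy)]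
      rw [← ofReal_integral_eq_lintegral_ofReal, integral_div]
      · refine (nu_ph_int ν hν _ (by fun_prop) (max 1 l) (le_max_left _ _) ?_).div_const _
        intro y hy
        exact ⟨by positivity, mul_le_mul_of_nonneg_right (le_max_right _ _) hy.le⟩
      · exact ae_of_all _ fun y => div_nonneg (ph_nonneg _) (by positivity)
  have h2 : lap (Jm b c ν) l = ENNReal.ofReal c + lap (volume.withDensity (kap b ν)) l := by
    unfold lap Jm
    rw [lintegral_add_measure, lintegral_smul_measure, lintegral_dirac]
    simp
  have : 0 ≤ ∫ y in Ioi (0:ℝ), ph (l * y) ∂ν := integral_nonneg fun y => ph_nonneg _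
  rw [h2, h1, ← ENNReal.ofReal_add (by positivity) (by positivity), ← ENNReal.ofReal_add (by positivity) (by positivity), phi_eq]
  congr 1
  field_simp
  ring

/-- `J * W = x` -/
lemma J_W (b c : ℝ) (hb : 0 ≤ b) (hc : 0 < c) (ν : Measure ℝ)
    (hν : ∫⁻ y in Set.Ioi (0 : ℝ), ENNReal.ofReal (min y (y ^ 2)) ∂ν ≠ ⊤)
    (W : ℝ → ℝ) (hWm : Measurable W) (hWneg : ∀ x : ℝ, x < 0 → W x = 0)
    (hWnonneg : ∀ x : ℝ, 0 ≤ W x)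
    (hWlap : ∀ l : ℝ, 0 < l →
      (∫ x in Set.Ioi (0 : ℝ), Real.exp (-l * x) * W x) = 1 / phi b c ν l) :
    (Jm b c ν).conv (volume.withDensity fun x => ENNReal.ofReal (W x)) = ell.conv ell := by
  have hi : (fun x => ENNReal.ofReal (W x)) = (Ici (0:ℝ)).indicator (fun x => ENNReal.ofReal (W x)) := by
    ext x
    by_cases hx : 0 ≤ x
    · simp [hx]
    · simp [hx, hWneg x (not_le.1 hx)]
  have hL : ∀ l : ℝ, 0 < l → lap ((Jm b c ν).conv (volume.withDensity fun x => ENNReal.ofReal (W x))) l = ENNReal.ofReal (1 / l^2) := by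
    intro l hl
    have hp := phi_pos b c hb hc ν l hl
    rw [lap_conv, lap_J b c hb hc ν hν l hl, hi, lap_wd _ (by fun_prop)]
    simp_rw [← ENNReal.ofReal_mul (Real.exp_pos _).le]
    rw [← ofReal_integral_eq_lintegral_ofReal, hWlap l hl, ← ENNReal.ofReal_mul (by positivity)]
    · congr 1; field_simp
    · by_contra hn
      have := hWlap l hl
      rw [integral_undef hn] at this
      have h3 : 0 < 1 / phi b c ν l := by positivity
      linarith
    · exact ae_of_all _ fun x => mul_nonneg (by positivity) (hWnonneg x)
  have hE : ∀ l : ℝ, 0 < l → lap (ell.conv ell) l = ENNReal.ofReal (1 / l^2) := by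
    intro l hl
    rw [lap_conv, lap_ell l hl, ← ENNReal.ofReal_mul (by positivity)]; congr 1; field_simp
  apply laplace_unique
  · intro l hl
    have := hL l hl
    unfold lap at this
    rw [this]; simp
  · intro l hl
    exact (hL l hl).trans (hE l hl).symm

lemma J_conv_wd (b c : ℝ) (ν : Measure ℝ) (hs : SFinite (ν.restrict (Ioi 0))) (f : ℝ → ℝ≥0∞) (hf : Measurable f) :
    (Jm b c ν).conv (volume.withDensity f) =
      volume.withDensity (fun t => ENNReal.ofReal c * f t + ∫⁻ s, kap b ν (t - s) * f s) := by
  have hk := kap_meas b ν hs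
  unfold Jm
  rw [Measure.add_conv, Measure.conv_smul_left, Measure.dirac_zero_conv, conv_wd _ _ hk, ← withDensity_smul _ hf,
    ← withDensity_add_left (hf.const_smul _)]
  congr 1
  ext t
  simp only [Pi.add_apply, Pi.smul_apply, smul_eq_mul]
  congr 1
  rw [lintegral_withDensity_eq_lintegral_mul _ hf (by fun_prop)]
  refine lintegral_congr fun s => ?_
  simp [mul_comm]

structure Ker (b c : ℝ) (ν : Measure ℝ) (W k : ℝ → ℝ) : Prop where
  meas : Measurable k
  nn : ∀ x, 0 ≤ k x
  le : ∀ x, k x ≤ 1 / c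
  neg : ∀ x, x < 0 → k x = 0
  cont : ContinuousOn k (Ici 0)
  prim : ∀ t, ENNReal.ofReal (W t) = ∫⁻ r in Iic t, ENNReal.ofReal (k r)
  res : (Jm b c ν).conv (volume.withDensity fun x => ENNReal.ofReal (k x)) = ell

lemma ell_Iic (t : ℝ) : ell (Iic t) = ENNReal.ofReal t := by
  unfold ell
  rw [withDensity_apply _ measurableSet_Iic, lintegral_indicator measurableSet_Ici]
  simp [Measure.restrict_restrict, Ici_inter_Iic]

lemma ker_of
    (b c : ℝ) (hb : 0 ≤ b) (hc : 0 < c)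
    (ν : Measure ℝ)
    (hνint : ∫⁻ y in Set.Ioi (0 : ℝ), ENNReal.ofReal (min y (y ^ 2)) ∂ν ≠ ⊤)
    (W W' : ℝ → ℝ)
    (hWneg : ∀ x : ℝ, x < 0 → W x = 0)
    (hWnonneg : ∀ x : ℝ, 0 ≤ W x)
    (hWcont : ContinuousOn W (Set.Ici 0))
    (hWmono : StrictMonoOn W (Set.Ici 0))
    (hWlap : ∀ l : ℝ, 0 < l →
      (∫ x in Set.Ioi (0 : ℝ), Real.exp (-l * x) * W x) = 1 / phi b c ν l)
    (hW'neg : ∀ x : ℝ, x < 0 → W' x = 0)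
    (hW'zero : W' 0 = 1 / c)
    (hW'deriv : ∀ x : ℝ, 0 < x → HasDerivAt W (W' x) x)
    (hW'cont : ContinuousOn W' (Set.Ici 0)) : Ker b c ν W W' := by
  have hs := nu_sfin ν hνint
  have mono : Monotone W := by
    intro x y hxy
    by_cases hx : 0 ≤ x
    · exact hWmono.monotoneOn hx (hx.trans hxy) hxy
    · rw [hWneg x (not_le.1 hx)]; exact hWnonneg y
  have hWm := mono.measurable
  have hk : Measurable W' := by
    have : W' = (Ici (0:ℝ)).piecewise W' (fun _ => 0) := by
      ext x
      by_cases hx : 0 ≤ x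
      · simp [hx]
      · simp [hx, hW'neg x (not_le.1 hx)]
    rw [this]
    exact ContinuousOn.measurable_piecewise hW'cont continuousOn_const measurableSet_Ici
  have nn : ∀ x, 0 ≤ W' x := by
    intro x
    rcases lt_trichotomy x 0 with h | h | h
    · rw [hW'neg x h]
    · rw [h, hW'zero]; positivity
    · exact (hW'deriv x h).deriv ▸ mono.deriv_nonneg
  have rc : ∀ (f : ℝ → ℝ), ContinuousOn f (Ici 0) → ∀ t, 0 ≤ t → ContinuousWithinAt f (Ici t) t :=
    fun f hf t ht => (hf t ht).mono (Ici_subset_Ici.2 ht)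
  have JW := J_W b c hb hc ν hνint W hWm hWneg hWnonneg hWlap
  have W0 : W 0 = 0 := by
    have h1 := JW
    rw [J_conv_wd b c ν hs _ (by fun_prop), ell_conv] at h1
    have hkm := kap_meas b ν hs
    have h2 := ae_of_wd_eq _ _ (Measurable.add (by fun_prop) (Measurable.lintegral_prod_right' (f := fun p : ℝ × ℝ => kap b ν (p.1 - p.2) * ENNReal.ofReal (W p.2)) (by fun_prop)))
      (Monotone.measurable fun a b hab => measure_mono (Iic_subset_Iic.2 hab)) h1
    have h3 := rc_upgrade (fun t => max (c * W t) t) (fun t => t) (by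
      filter_upwards [h2] with t ht ht0
      rw [ell_Iic] at ht
      refine max_eq_right ?_
      rw [← ENNReal.ofReal_le_ofReal_iff ht0, ENNReal.ofReal_mul hc.le, ← ht]
      exact le_self_add) 0 le_rfl
      (((rc W hWcont 0 le_rfl).const_mul c).max continuousWithinAt_id) continuousWithinAt_id
    have h4 : c * W 0 ≤ 0 := by have := le_max_left (c * W 0) 0; linarith
    exact le_antisymm (by by_contra h; push Not at h; nlinarith) (hWnonneg 0)
  have prim : ∀ t, ENNReal.ofReal (W t) = ∫⁻ r in Iic t, ENNReal.ofReal (W' r) := by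
    intro t
    have hz : ∫⁻ r in Iio 0, ENNReal.ofReal (W' r) = 0 := by
      rw [setLIntegral_congr_fun (g := fun _ => 0) measurableSet_Iio (fun x hx => by
        simp [hW'neg x hx])]
      simp
    by_cases ht : 0 ≤ t
    · have h1 : ∫ x in (0:ℝ)..t, W' x = W t - W 0 :=
        intervalIntegral.integral_eq_sub_of_hasDerivAt_of_le ht (hWcont.mono Icc_subset_Ici_self)
          (fun x hx => hW'deriv x hx.1) ((hW'cont.mono (by rw [uIcc_of_le ht]; exact Icc_subset_Ici_self)).intervalIntegrable)
      have hi : IntegrableOn W' (Icc 0 t) := (hW'cont.mono Icc_subset_Ici_self).integrableOn_Icc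
      rw [W0, sub_zero, intervalIntegral.integral_of_le ht, ← integral_Icc_eq_integral_Ioc] at h1
      rw [← h1, ofReal_integral_eq_lintegral_ofReal hi (ae_of_all _ nn)]
      rw [← Iio_union_Icc_eq_Iic ht, lintegral_union measurableSet_Icc (by
        rw [disjoint_left]; intro x hx hx2; exact absurd hx2.1 (not_le.2 hx)), hz, zero_add]
    · rw [hWneg t (not_le.1 ht)]
      rw [eq_comm, ENNReal.ofReal_zero]
      exact le_antisymm (hz ▸ lintegral_mono_set (fun x hx => lt_of_le_of_lt hx (not_le.1 ht))) zero_le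
  have res : (Jm b c ν).conv (volume.withDensity fun x => ENNReal.ofReal (W' x)) = ell := by
    symm
    have hkm := kap_meas b ν hs
    have hW' : ell.conv (volume.withDensity fun x => ENNReal.ofReal (W' x)) = volume.withDensity fun x => ENNReal.ofReal (W x) := by
      rw [ell_conv]; congr 1; ext t; rw [prim t, withDensity_apply _ measurableSet_Iic]
    apply ell_cancel
    · intro t; rw [ell_Iic]; simp
    · unfold ell
      rw [withDensity_apply _ measurableSet_Iio, lintegral_indicator measurableSet_Ici, Measure.restrict_restrict measurableSet_Ici]
      simp [Ici_inter_Iio]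
    · rw [J_conv_wd b c ν hs _ (by fun_prop), withDensity_apply _ measurableSet_Iio]
      rw [setLIntegral_congr_fun (g := fun _ => 0) measurableSet_Iio]
      · simp
      · intro t ht
        have ht : t < 0 := ht
        have : ∀ s, kap b ν (t - s) * ENNReal.ofReal (W' s) = 0 := by
          intro s
          by_cases h : s < 0
          · simp [hW'neg s h]
          · simp only [kap]; rw [indicator_of_notMem]
            · simp
            · simp only [mem_Ici]; linarith
        simp [hW'neg t ht, this]
    · rw [Measure.conv_comm ell (Measure.conv _ _), Measure.conv_assoc, Measure.conv_comm (volume.withDensity fun x => ENNReal.ofReal (W' x)) ell, hW', JW]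
  refine ⟨hk, nn, ?_, hW'neg, hW'cont, prim, res⟩
  have hkm := kap_meas b ν hs
  have h1 := res
  rw [J_conv_wd b c ν hs _ (by fun_prop), ell] at h1
  have h2 := ae_of_wd_eq _ _ (Measurable.add (by fun_prop) (Measurable.lintegral_prod_right' (f := fun p : ℝ × ℝ => kap b ν (p.1 - p.2) * ENNReal.ofReal (W' p.2)) (by fun_prop)))
      (measurable_one.indicator measurableSet_Ici) h1
  intro x
  by_cases hx : 0 ≤ x
  · have h3 := rc_upgrade (fun t => max (c * W' t) 1) (fun t => 1) (by
      filter_upwards [h2] with t ht ht0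
      rw [indicator_of_mem (by exact ht0)] at ht
      refine max_eq_right ?_
      rw [← ENNReal.ofReal_le_ofReal_iff zero_le_one, ENNReal.ofReal_mul hc.le, ENNReal.ofReal_one]
      refine le_trans le_self_add ht.le) x hx
      (((rc W' hW'cont x hx).const_mul c).max continuousWithinAt_const) continuousWithinAt_const
    have h4 := le_max_left (c * W' x) 1
    rw [le_div_iff₀ hc]; linarith
  · rw [hW'neg x (not_le.1 hx)]; positivity

structure Nice (f : ℝ → ℝ) : Prop where
  meas : Measurable f
  nn : ∀ t, 0 ≤ f t
  bd : ∀ T, ∃ M, 1 ≤ M ∧ ∀ t ≤ T, f t ≤ M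

lemma Nice.ii {f : ℝ → ℝ} (h : Nice f) (a b : ℝ) : IntervalIntegrable f volume a b := by
  obtain ⟨M, hM, hb⟩ := h.bd (max a b)
  rw [intervalIntegrable_iff]
  refine Measure.integrableOn_of_bounded (M := M) (by simp) h.meas.aestronglyMeasurable ?_
  filter_upwards [ae_restrict_mem measurableSet_uIoc] with x hx
  rw [Real.norm_eq_abs, abs_of_nonneg (h.nn x)]
  exact hb x hx.2

lemma Nice.prim_cont {f : ℝ → ℝ} (h : Nice f) : Continuous fun t => ∫ r in (0:ℝ)..t, f r :=
  intervalIntegral.continuous_primitive h.ii 0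

lemma Nice.F_meas {f : ℝ → ℝ} (h : Nice f) :
    Continuous fun p : ℝ × ℝ => ∫ r in (max (p.1 - p.2) 0)..p.1, f r := by
  have : (fun p : ℝ × ℝ => ∫ r in (max (p.1 - p.2) 0)..p.1, f r) = fun p : ℝ × ℝ =>
      (∫ r in (0:ℝ)..p.1, f r) - ∫ r in (0:ℝ)..(max (p.1 - p.2) 0), f r := by
    ext p
    rw [intervalIntegral.integral_interval_sub_left (h.ii _ _) (h.ii _ _)]
  rw [this]
  have := h.prim_cont
  exact (this.comp continuous_fst).sub (this.comp (by fun_prop : Continuous fun p : ℝ × ℝ => max (p.1 - p.2) 0))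

lemma Rop_eq (c : ℝ) (ν : Measure ℝ) (f : ℝ → ℝ) (t : ℝ) :
    Rop c ν f t = c * f t ^ 2 + ∫ y in Ioi (0:ℝ), ph (∫ r in (max (t - y) 0)..t, f r) ∂ν := rfl

lemma Rop_congr (c : ℝ) (ν : Measure ℝ) (f g : ℝ → ℝ) (h : ∀ t, 0 ≤ t → f t = g t) (t : ℝ) (ht : 0 ≤ t) :
    Rop c ν f t = Rop c ν g t := by
  rw [Rop_eq, Rop_eq, h t ht]
  congr 1
  refine setIntegral_congr_fun measurableSet_Ioi fun y hy => ?_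
  have hy : 0 < y := hy
  congr 1
  refine intervalIntegral.integral_congr fun r hr => ?_
  rw [uIcc_of_le (max_le (by linarith) ht)] at hr
  exact h r ((le_max_right _ _).trans hr.1)

lemma Rop_nn (c : ℝ) (hc : 0 < c) (ν : Measure ℝ) (f : ℝ → ℝ) (t : ℝ) : 0 ≤ Rop c ν f t := by
  rw [Rop_eq]
  have : 0 ≤ ∫ y in Ioi (0:ℝ), ph (∫ r in (max (t - y) 0)..t, f r) ∂ν := integral_nonneg fun y => ph_nonneg _
  positivity

lemma Rop_meas (c : ℝ) (ν : Measure ℝ) (hs : SFinite (ν.restrict (Ioi 0))) (f : ℝ → ℝ) (h : Nice f) :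
    Measurable (Rop c ν f) := by
  have h1 : Measurable fun p : ℝ × ℝ => ph (∫ r in (max (p.1 - p.2) 0)..p.1, f r) := ph_meas.comp h.F_meas.measurable
  have h2 : Measurable fun t => ∫ y in Ioi (0:ℝ), ph (∫ r in (max (t - y) 0)..t, f r) ∂ν :=
    (h1.stronglyMeasurable.integral_prod_right' (ν := ν.restrict (Ioi 0))).measurable
  have := h.meas
  exact Measurable.add (by fun_prop) h2

lemma F_bd {f : ℝ → ℝ} (h : Nice f) (M s y : ℝ) (hs : 0 ≤ s) (hy : 0 < y) (hM : ∀ t ≤ s, f t ≤ M) :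
    0 ≤ ∫ r in (max (s - y) 0)..s, f r ∧ ∫ r in (max (s - y) 0)..s, f r ≤ M * y := by
  have hle : max (s - y) 0 ≤ s := max_le (by linarith) hs
  have hM0 : 0 ≤ M := (h.nn s).trans (hM s le_rfl)
  refine ⟨intervalIntegral.integral_nonneg hle fun r _ => h.nn r, ?_⟩
  have := intervalIntegral.integral_mono_on (f := f) (g := fun _ => M) hle (h.ii _ _) (by simp) (fun r hr => hM r hr.2)
  rw [intervalIntegral.integral_const, smul_eq_mul] at this
  refine this.trans ?_
  rw [mul_comm]
  exact mul_le_mul_of_nonneg_left (by linarith [le_max_left (s-y) 0]) hM0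

lemma Rop_int (ν : Measure ℝ)
    (hν : ∫⁻ y in Set.Ioi (0 : ℝ), ENNReal.ofReal (min y (y ^ 2)) ∂ν ≠ ⊤) {f : ℝ → ℝ} (h : Nice f)
    (s : ℝ) (hs : 0 ≤ s) :
    Integrable (fun y => ph (∫ r in (max (s - y) 0)..s, f r)) (ν.restrict (Ioi 0)) := by
  obtain ⟨M, hM1, hM⟩ := h.bd s
  refine nu_ph_int ν hν _ ?_ M hM1 fun y hy => F_bd h M s y hs hy hM
  exact (h.F_meas.comp (Continuous.prodMk_right s)).measurable

lemma Rop_diff (c : ℝ) (hc : 0 < c) (ν : Measure ℝ)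
    (hν : ∫⁻ y in Set.Ioi (0 : ℝ), ENNReal.ofReal (min y (y ^ 2)) ∂ν ≠ ⊤) {f g : ℝ → ℝ} (hf : Nice f) (hg : Nice g)
    (s M D : ℝ) (hs : 0 ≤ s) (hM1 : 1 ≤ M) (hfM : ∀ t ≤ s, f t ≤ M) (hgM : ∀ t ≤ s, g t ≤ M)
    (hD : ∀ t, 0 ≤ t → t ≤ s → |f t - g t| ≤ D) :
    |Rop c ν f s - Rop c ν g s| ≤ (2 * c * M + M * ∫ y in Ioi (0:ℝ), min y (y^2) ∂ν) * D := by
  have hD0 : 0 ≤ D := (abs_nonneg _).trans (hD s hs le_rfl)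
  rw [Rop_eq, Rop_eq, add_sub_add_comm, ← integral_sub (Rop_int ν hν hf s hs) (Rop_int ν hν hg s hs)]
  refine (abs_add_le _ _).trans ?_
  rw [add_mul]
  refine add_le_add ?_ ?_
  · rw [← mul_sub, sq_sub_sq, abs_mul, abs_mul, abs_of_pos hc, abs_of_nonneg (add_nonneg (hf.nn _) (hg.nn _))]
    have h1 := hfM s le_rfl
    have h2 := hgM s le_rfl
    have h3 := hD s hs le_rfl
    calc c * ((f s + g s) * |f s - g s|) ≤ c * ((M + M) * D) := by
          have := hf.nn s; have := hg.nn s; gcongr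
      _ = _ := by ring
  · rw [← Real.norm_eq_abs]
    refine (norm_integral_le_of_norm_le (g := fun y => M * min y (y^2) * D) (((nu_int ν hν).const_mul M).mul_const D) ?_).trans ?_
    · filter_upwards [ae_restrict_mem measurableSet_Ioi] with y hy
      have hy : 0 < y := hy
      have a := F_bd hf M s y hs hy hfM
      have b := F_bd hg M s y hs hy hgM
      rw [Real.norm_eq_abs]
      refine (ph_diff _ _ _ a.1 b.1 a.2 b.2).trans ?_
      have hle : max (s - y) 0 ≤ s := max_le (by linarith) hs
      have e : |(∫ r in (max (s - y) 0)..s, f r) - ∫ r in (max (s - y) 0)..s, g r| ≤ y * D := by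
        rw [← intervalIntegral.integral_sub (hf.ii _ _) (hg.ii _ _), ← Real.norm_eq_abs]
        refine (intervalIntegral.norm_integral_le_of_norm_le_const (C := D) ?_).trans ?_
        · intro r hr
          rw [uIoc_of_le hle] at hr
          exact hD r ((le_max_right _ _).trans hr.1.le) hr.2
        · rw [abs_of_nonneg (by linarith), mul_comm]
          exact mul_le_mul_of_nonneg_right (by linarith [le_max_left (s-y) 0]) hD0
      calc _ ≤ min 1 (M * y) * (y * D) := mul_le_mul_of_nonneg_left e (le_min zero_le_one (by positivity))
        _ = (min 1 (M * y) * y) * D := by ring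
        _ ≤ _ := mul_le_mul_of_nonneg_right (min_scale M y hM1 hy) hD0
    · rw [integral_mul_const, integral_const_mul]

lemma Rop_zero (c : ℝ) (ν : Measure ℝ) (s : ℝ) : Rop c ν (fun _ => 0) s = 0 := by simp [Rop]

lemma nice_zero : Nice fun _ => 0 := ⟨measurable_const, fun _ => le_rfl, fun _ => ⟨1, le_rfl, fun _ _ => zero_le_one⟩⟩

lemma Rop_bd (c : ℝ) (hc : 0 < c) (ν : Measure ℝ)
    (hν : ∫⁻ y in Set.Ioi (0 : ℝ), ENNReal.ofReal (min y (y ^ 2)) ∂ν ≠ ⊤) {f : ℝ → ℝ} (hf : Nice f)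
    (T : ℝ) : ∃ B, ∀ s, 0 ≤ s → s ≤ T → Rop c ν f s ≤ B := by
  obtain ⟨M, hM1, hM⟩ := hf.bd T
  refine ⟨(2 * c * M + M * ∫ y in Ioi (0:ℝ), min y (y^2) ∂ν) * M, fun s hs hsT => ?_⟩
  have := Rop_diff c hc ν hν hf nice_zero s M M hs hM1 (fun t ht => hM t (ht.trans hsT)) (fun t ht => by linarith)
    (fun t _ ht => by simp only [sub_zero]; rw [abs_of_nonneg (hf.nn t)]; exact hM t (ht.trans hsT))
  rw [Rop_zero, sub_zero] at this
  exact (le_abs_self _).trans this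

lemma Rk_int (b c : ℝ) (hc : 0 < c) (ν : Measure ℝ)
    (hν : ∫⁻ y in Set.Ioi (0 : ℝ), ENNReal.ofReal (min y (y ^ 2)) ∂ν ≠ ⊤) {W k : ℝ → ℝ} (K : Ker b c ν W k)
    {f : ℝ → ℝ} (hf : Nice f) (t : ℝ) (ht : 0 ≤ t) :
    IntervalIntegrable (fun s => Rop c ν f s * k (t - s)) volume 0 t := by
  obtain ⟨B, hB⟩ := Rop_bd c hc ν hν hf t
  have hm := Rop_meas c ν (nu_sfin ν hν) f hf
  have := K.meas
  rw [intervalIntegrable_iff]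
  refine Measure.integrableOn_of_bounded (M := B * (1 / c)) (by simp) (by fun_prop) ?_
  filter_upwards [ae_restrict_mem measurableSet_uIoc] with s hs
  rw [uIoc_of_le ht] at hs
  rw [Real.norm_eq_abs, abs_of_nonneg (mul_nonneg (Rop_nn c hc ν f s) (K.nn _))]
  exact mul_le_mul (hB s hs.1.le hs.2) (K.le _) (K.nn _) ((Rop_nn c hc ν f s).trans (hB s hs.1.le hs.2))

lemma uniq (b c : ℝ) (hc : 0 < c) (ν : Measure ℝ)
    (hν : ∫⁻ y in Set.Ioi (0 : ℝ), ENNReal.ofReal (min y (y ^ 2)) ∂ν ≠ ⊤) (W k : ℝ → ℝ) (K : Ker b c ν W k)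
    (μ : Measure ℝ) (f g : ℝ → ℝ) (hf : Nice f) (hg : Nice g)
    (ef : ∀ t : ℝ, 0 ≤ t → f t = volterraRHS c ν μ k f t)
    (eg : ∀ t : ℝ, 0 ≤ t → g t = volterraRHS c ν μ k g t) (T : ℝ) (hT : 0 ≤ T) : f T = g T := by
  obtain ⟨M1, hM1, hM1b⟩ := hf.bd T
  obtain ⟨M2, hM2, hM2b⟩ := hg.bd T
  set M := max M1 M2
  have hM : 1 ≤ M := hM1.trans (le_max_left _ _)
  set C := (2 * c * M + M * ∫ y in Ioi (0:ℝ), min y (y^2) ∂ν)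
  have hC : 0 < C := by
    have : 0 ≤ ∫ y in Ioi (0:ℝ), min y (y^2) ∂ν := by
      refine setIntegral_nonneg measurableSet_Ioi fun y hy => ?_
      have hy : 0 < y := hy
      positivity
    have : 0 < M := by linarith
    positivity
  set a := 2 * C / c
  have ha : 0 < a := by positivity
  have main : ∀ n : ℕ, ∀ t, 0 ≤ t → t ≤ T → |f t - g t| ≤ (2 * M) * (1/2)^n * Real.exp (a * t) := by
    intro n
    induction n with
    | zero =>
      intro t ht htT
      have h1 := hM1b t htT
      have h2 := hM2b t htT
      have h3 := hf.nn t
      have h4 := hg.nn t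
      have h5 := le_max_left M1 M2
      have h6 := le_max_right M1 M2
      have h7 : 1 ≤ Real.exp (a * t) := Real.one_le_exp (by positivity)
      have : |f t - g t| ≤ 2 * M := by rw [abs_le]; constructor <;> linarith
      rw [pow_zero, mul_one]
      nlinarith
    | succ n ih =>
      intro t ht htT
      set Dn := (2 * M) * (1/2:ℝ)^n
      have hDn : 0 ≤ Dn := by positivity
      have e1 : f t - g t = - ∫ s in (0:ℝ)..t, (Rop c ν f s * k (t - s) - Rop c ν g s * k (t - s)) := by
        rw [ef t ht, eg t ht, intervalIntegral.integral_sub (Rk_int b c hc ν hν K hf t ht) (Rk_int b c hc ν hν K hg t ht)]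
        unfold volterraRHS; ring
      rw [e1, abs_neg, ← Real.norm_eq_abs]
      have e2 : ∫ s in (0:ℝ)..t, C * Dn / c * Real.exp (a * s) = C * Dn / c * ((Real.exp (a * t) - 1) / a) := by
        rw [intervalIntegral.integral_const_mul, intervalIntegral.integral_comp_mul_left (fun x => Real.exp x) ha.ne', integral_exp]
        rw [mul_zero, Real.exp_zero, smul_eq_mul]; ring
      have e3 : ‖∫ s in (0:ℝ)..t, (Rop c ν f s * k (t - s) - Rop c ν g s * k (t - s))‖ ≤ ∫ s in (0:ℝ)..t, C * Dn / c * Real.exp (a * s) := by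
        refine intervalIntegral.norm_integral_le_of_norm_le ht ?_ (Continuous.intervalIntegrable (by fun_prop) _ _)
        refine ae_of_all _ fun s hs => ?_
        rw [← sub_mul, Real.norm_eq_abs, abs_mul, abs_of_nonneg (K.nn _)]
        have h1 := Rop_diff c hc ν hν hf hg s M (Dn * Real.exp (a * s)) hs.1.le hM
          (fun r hr => (hM1b r (hr.trans (hs.2.trans htT))).trans (le_max_left _ _))
          (fun r hr => (hM2b r (hr.trans (hs.2.trans htT))).trans (le_max_right _ _))
          (fun r hr hrs => (ih r hr (hrs.trans (hs.2.trans htT))).trans (by gcongr))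
        calc _ ≤ (C * (Dn * Real.exp (a * s))) * (1 / c) := mul_le_mul h1 (K.le _) (K.nn _) (by positivity)
          _ = _ := by ring
      refine e3.trans ?_
      rw [e2, pow_succ]
      have e4 : C * Dn / c * ((Real.exp (a * t) - 1) / a) = Dn * (1/2) * (Real.exp (a * t) - 1) := by
        simp only [a]; field_simp
      rw [e4, ← mul_assoc]
      exact mul_le_mul_of_nonneg_left (by linarith) (by positivity)
  have lim : Tendsto (fun n : ℕ => (2 * M) * (1/2:ℝ)^n * Real.exp (a * T)) atTop (𝓝 ((2*M) * 0 * Real.exp (a * T))) :=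
    ((tendsto_pow_atTop_nhds_zero_of_lt_one (by norm_num) (by norm_num)).const_mul _).mul_const _
  have := ge_of_tendsto' lim fun n => main n T hT le_rfl
  rw [mul_zero, zero_mul] at this
  linarith [abs_nonpos_iff.1 this]

lemma meas_of_rc (f : ℝ → ℝ) (h : ∀ t, ContinuousWithinAt f (Ici t) t) : Measurable f := by
  refine measurable_of_tendsto_metrizable (f := fun (n : ℕ) t => f ((⌊((n:ℝ)+1) * t⌋ + 1 : ℝ) / ((n:ℝ)+1))) ?_ ?_
  · intro n
    have h1 : Measurable fun t : ℝ => ⌊((n:ℝ)+1) * t⌋ := Int.measurable_floor.comp (by fun_prop)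
    exact (measurable_from_top (f := fun z : ℤ => f ((z + 1 : ℝ) / ((n:ℝ)+1)))).comp h1
  · rw [tendsto_pi_nhds]
    intro t
    refine (h t).tendsto.comp ?_
    have lo : ∀ n : ℕ, t ≤ (⌊((n:ℝ)+1) * t⌋ + 1 : ℝ) / ((n:ℝ)+1) := by
      intro n
      rw [le_div_iff₀ (by positivity), mul_comm]
      exact (Int.lt_floor_add_one _).le
    have up : ∀ n : ℕ, (⌊((n:ℝ)+1) * t⌋ + 1 : ℝ) / ((n:ℝ)+1) ≤ t + 1 / ((n:ℝ)+1) := by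
      intro n
      have e : (t + 1 / ((n:ℝ)+1)) * ((n:ℝ)+1) = ((n:ℝ)+1) * t + 1 := by field_simp
      rw [div_le_iff₀ (by positivity), e]
      linarith [Int.floor_le (((n:ℝ)+1) * t)]
    rw [tendsto_nhdsWithin_iff]
    refine ⟨tendsto_of_tendsto_of_tendsto_of_le_of_le tendsto_const_nhds ?_ lo up, Eventually.of_forall lo⟩
    simpa using tendsto_one_div_add_atTop_nhds_zero_nat.const_add t

lemma Ker.W_le {b c : ℝ} {ν : Measure ℝ} {W k : ℝ → ℝ} (K : Ker b c ν W k) (t : ℝ) :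
    ENNReal.ofReal (W t) ≤ ENNReal.ofReal (1 / c) * ENNReal.ofReal t := by
  rw [K.prim t, ← ell_Iic t, ell, withDensity_apply _ measurableSet_Iic, ← lintegral_const_mul _ (measurable_one.indicator measurableSet_Ici)]
  refine lintegral_mono fun x => ?_
  by_cases hx : 0 ≤ x
  · simp only [mem_Ici, hx, indicator_of_mem, Pi.one_apply, mul_one]
    exact ENNReal.ofReal_le_ofReal (K.le x)
  · simp [K.neg x (not_le.1 hx)]

lemma Ker.W_meas {b c : ℝ} {ν : Measure ℝ} {W k : ℝ → ℝ} (K : Ker b c ν W k) :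
    Measurable fun t => ENNReal.ofReal (W t) := by
  apply Monotone.measurable
  intro x y hxy
  simp only [K.prim]
  exact lintegral_mono_set (Iic_subset_Iic.2 hxy)

noncomputable def Un (W : ℝ → ℝ) (μ : Measure ℝ) : ℕ → ℝ → ℝ≥0∞
  | 0 => fun _ => 1
  | n + 1 => fun t => 1 + ∫⁻ s, ENNReal.ofReal (W (t - s)) * Un W μ n s ∂μ

lemma exU (b c : ℝ) (hc : 0 < c) (ν : Measure ℝ) (W k : ℝ → ℝ) (K : Ker b c ν W k)
    (μ : Measure ℝ) [SigmaFinite μ] (hμ0 : μ (Set.Iio 0) = 0)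
    (hμfin : ∀ t : ℝ, 0 ≤ t → μ (Set.Icc 0 t) ≠ ⊤) :
    ∃ U : ℝ → ℝ, Nice U ∧ (∀ t, 1 ≤ U t) ∧
      ∀ t, ENNReal.ofReal (U t) = 1 + ∫⁻ s, ENNReal.ofReal (W (t - s)) * ENNReal.ofReal (U s) ∂μ := by
  have hW := K.W_meas
  have hae : ∀ᵐ s ∂μ, 0 ≤ s := by
    rw [ae_iff]; simp only [not_le]; exact hμ0
  have hW0 : ∀ x ≤ 0, ENNReal.ofReal (W x) = 0 := fun x hx => by
    have := K.W_le x
    rw [ENNReal.ofReal_of_nonpos hx, mul_zero] at this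
    exact le_antisymm this zero_le
  have meas : ∀ n, Measurable (Un W μ n) := by
    intro n
    induction n with
    | zero => exact measurable_const
    | succ n ih =>
      have := Measurable.lintegral_prod_right' (ν := μ) (f := fun p : ℝ × ℝ => ENNReal.ofReal (W (p.1 - p.2)) * Un W μ n p.2)
        (Measurable.mul (hW.comp (measurable_fst.sub measurable_snd)) (ih.comp measurable_snd))
      exact Measurable.add measurable_const this
  have mono : Monotone (Un W μ) := by
    apply monotone_nat_of_le_succ
    intro n
    induction n with
    | zero => intro t; simp only [Un]; exact le_self_add
    | succ n ih =>
      intro t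
      simp only [Un]
      gcongr with s
      exact ih s
  have neg : ∀ n, ∀ t < 0, Un W μ n t = 1 := by
    intro n t ht
    cases n with
    | zero => rfl
    | succ n =>
      simp only [Un]
      rw [lintegral_congr_ae (g := fun _ => 0)]
      · simp
      · filter_upwards [hae] with s hs
        rw [hW0 _ (by linarith), zero_mul]
  have bound : ∀ T, 0 ≤ T → ∃ a > 0, ∀ n t, 0 ≤ t → t ≤ T → Un W μ n t ≤ ENNReal.ofReal (2 * Real.exp (a * t)) := by
    intro T hT
    set M := (μ (Icc 0 T)).toReal + 1
    have hM : 0 < M := by positivity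
    have hMμ : μ (Icc 0 T) ≤ ENNReal.ofReal M := by
      rw [← ENNReal.ofReal_toReal (hμfin T hT)]
      exact ENNReal.ofReal_le_ofReal (by simp [M])
    refine ⟨2 * M / c, by positivity, ?_⟩
    set a := 2 * M / c
    have ha : 0 < a := by positivity
    intro n
    induction n with
    | zero =>
      intro t ht _
      simp only [Un]
      rw [← ENNReal.ofReal_one]
      refine ENNReal.ofReal_le_ofReal ?_
      have : 1 ≤ Real.exp (a * t) := Real.one_le_exp (by positivity)
      linarith
    | succ n ih =>
      intro t ht htT
      simp only [Un]
      have h1 : ∫⁻ s, ENNReal.ofReal (W (t - s)) * Un W μ n s ∂μ ≤ ENNReal.ofReal (2 * Real.exp (a * t) / (c * a)) * μ (Icc 0 T) := by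
        rw [← lintegral_indicator_const measurableSet_Icc]
        refine lintegral_mono_ae ?_
        filter_upwards [hae] with s hs
        rcases le_total t s with h | h
        · rw [hW0 _ (by linarith), zero_mul]; exact zero_le
        · rw [indicator_of_mem (show s ∈ Icc 0 T from ⟨hs, h.trans htT⟩)]
          calc _ ≤ (ENNReal.ofReal (1 / c) * ENNReal.ofReal (t - s)) * ENNReal.ofReal (2 * Real.exp (a * s)) :=
                mul_le_mul' (K.W_le _) (ih s hs (h.trans htT))
            _ = ENNReal.ofReal (1 / c * (t - s) * (2 * Real.exp (a * s))) := by
                rw [ENNReal.ofReal_mul (p := 1 / c * (t - s)) (mul_nonneg (by positivity) (by linarith)), ENNReal.ofReal_mul (p := 1 / c) (by positivity)]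
            _ ≤ _ := by
                refine ENNReal.ofReal_le_ofReal ?_
                have e : Real.exp (a * t) = Real.exp (a * s) * Real.exp (a * (t - s)) := by
                  rw [← Real.exp_add]; congr 1; ring
                have e2 := Real.add_one_le_exp (a * (t - s))
                rw [le_div_iff₀ (by positivity), e]
                have e3 : 1 / c * (t - s) * (2 * Real.exp (a * s)) * (c * a) = 2 * (Real.exp (a * s) * (a * (t - s))) := by
                  field_simp
                rw [e3]
                have : Real.exp (a * s) * (a * (t - s)) ≤ Real.exp (a * s) * Real.exp (a * (t - s)) :=
                  mul_le_mul_of_nonneg_left (by linarith) (by positivity)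
                linarith
      refine (add_le_add le_rfl (h1.trans (mul_le_mul' le_rfl hMμ))).trans ?_
      rw [← ENNReal.ofReal_mul (by positivity), ← ENNReal.ofReal_one, ← ENNReal.ofReal_add zero_le_one (by positivity)]
      refine ENNReal.ofReal_le_ofReal ?_
      have : 1 ≤ Real.exp (a * t) := Real.one_le_exp (by positivity)
      have e : 2 * Real.exp (a * t) / (c * a) * M = Real.exp (a * t) := by
        simp only [a]; field_simp
      rw [e]; linarith
  set Ui : ℝ → ℝ≥0∞ := fun t => ⨆ n, Un W μ n t
  have Uim : Measurable Ui := Measurable.iSup meas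
  have bd : ∀ T, ∃ M : ℝ, 1 ≤ M ∧ ∀ t ≤ T, Ui t ≤ ENNReal.ofReal M := by
    intro T
    obtain ⟨a, ha, h⟩ := bound (max T 0) (le_max_right _ _)
    have h7 : 1 ≤ Real.exp (a * max T 0) := Real.one_le_exp (by positivity)
    refine ⟨2 * Real.exp (a * max T 0), by linarith, fun t ht => iSup_le fun n => ?_⟩
    by_cases h0 : 0 ≤ t
    · refine (h n t h0 (ht.trans (le_max_left _ _))).trans (ENNReal.ofReal_le_ofReal ?_)
      have := ht.trans (le_max_left T 0)
      gcongr
    · rw [neg n t (not_le.1 h0), ← ENNReal.ofReal_one]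
      exact ENNReal.ofReal_le_ofReal (by linarith)
  have fin : ∀ t, Ui t ≠ ⊤ := fun t => by
    obtain ⟨M, _, h⟩ := bd t
    exact ((h t le_rfl).trans_lt ENNReal.ofReal_lt_top).ne
  have eqn : ∀ t, Ui t = 1 + ∫⁻ s, ENNReal.ofReal (W (t - s)) * Ui s ∂μ := by
    intro t
    have h1 : ∫⁻ s, ENNReal.ofReal (W (t - s)) * Ui s ∂μ = ⨆ n, ∫⁻ s, ENNReal.ofReal (W (t - s)) * Un W μ n s ∂μ := by
      simp only [Ui, ENNReal.mul_iSup]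
      rw [lintegral_iSup]
      · intro n
        exact Measurable.mul (hW.comp (measurable_const.sub measurable_id)) (meas n)
      · intro i j hij s
        exact mul_le_mul' le_rfl (mono hij s)
    rw [h1, ENNReal.add_iSup]
    refine le_antisymm (iSup_le fun n => ?_) (iSup_le fun n => le_iSup (fun n => Un W μ n t) (n+1))
    refine le_trans ?_ (le_iSup _ n)
    exact mono (Nat.le_succ n) t
  refine ⟨fun t => (Ui t).toReal, ⟨Uim.ennreal_toReal, fun t => ENNReal.toReal_nonneg, ?_⟩, ?_, ?_⟩
  · intro T
    obtain ⟨M, h1, h⟩ := bd T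
    refine ⟨M, h1, fun t ht => ?_⟩
    exact ENNReal.toReal_le_of_le_ofReal (by linarith) (h t ht)
  · intro t
    rw [← ENNReal.toReal_one]
    exact ENNReal.toReal_mono (fin t) (by rw [eqn]; exact le_self_add)
  · intro t
    simp only [ENNReal.ofReal_toReal (fin _)]
    exact eqn t

lemma k_rc {b c : ℝ} {ν : Measure ℝ} {W k : ℝ → ℝ} (K : Ker b c ν W k) (x : ℝ) : ContinuousWithinAt k (Ici x) x := by
  by_cases hx : 0 ≤ x
  · exact (K.cont x hx).mono (Ici_subset_Ici.2 hx)
  · have : k =ᶠ[𝓝 x] fun _ => 0 := by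
      filter_upwards [Iio_mem_nhds (not_le.1 hx)] with y hy
      exact K.neg y hy
    exact (continuousAt_const.congr this.symm).continuousWithinAt

/-- convolution with `k` is càdlàg -/
lemma conv_facts (b c : ℝ) (hc : 0 < c) (ν : Measure ℝ) (W k : ℝ → ℝ) (K : Ker b c ν W k)
    (m : Measure ℝ) (hm0 : m (Iio 0) = 0) (hm : ∀ t : ℝ, 0 ≤ t → m (Icc 0 t) ≠ ⊤)
    (p : ℝ → ℝ) (hp : Measurable p) (hpn : ∀ t, 0 ≤ p t) (hpb : ∀ T, ∃ M, ∀ t, 0 ≤ t → t ≤ T → p t ≤ M) :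
    (∀ t, Integrable (fun s => k (t - s) * p s) m) ∧
    (∀ t, ContinuousWithinAt (fun t => ∫ s, k (t - s) * p s ∂m) (Ici t) t) ∧
    (∀ t, ∃ l, Tendsto (fun t => ∫ s, k (t - s) * p s ∂m) (𝓝[<] t) (𝓝 l)) := by
  have hk := K.meas
  have hae : ∀ᵐ s ∂m, 0 ≤ s := by
    rw [ae_iff]; simp only [not_le]; exact hm0
  have dom : ∀ T, ∃ g : ℝ → ℝ, Integrable g m ∧ ∀ t ≤ T, ∀ᵐ s ∂m, ‖k (t - s) * p s‖ ≤ g s := by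
    intro T
    obtain ⟨M, hM⟩ := hpb (max T 0)
    refine ⟨(Icc 0 (max T 0)).indicator fun _ => 1 / c * M, ?_, ?_⟩
    · rw [integrable_indicator_iff measurableSet_Icc]
      exact integrableOn_const (hm _ (le_max_right _ _))
    · intro t ht
      filter_upwards [hae] with s hs
      rw [Real.norm_eq_abs, abs_of_nonneg (mul_nonneg (K.nn _) (hpn _))]
      by_cases hst : s ≤ t
      · have h1 : s ≤ max T 0 := (hst.trans ht).trans (le_max_left _ _)
        rw [indicator_of_mem (show s ∈ Icc 0 (max T 0) from ⟨hs, h1⟩)]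
        exact mul_le_mul (K.le _) (hM s hs h1) (hpn s) (by positivity)
      · rw [K.neg _ (by linarith), zero_mul]
        refine indicator_nonneg (fun x hx => ?_) s
        exact mul_nonneg (by positivity) ((hpn x).trans (hM x hx.1 hx.2))
  have ms : ∀ t, AEStronglyMeasurable (fun s => k (t - s) * p s) m := fun t => by fun_prop
  refine ⟨fun t => ?_, fun t => ?_, fun t => ?_⟩
  · obtain ⟨g, hg, h⟩ := dom t
    exact hg.mono' (ms t) (h t le_rfl)
  · obtain ⟨g, hg, h⟩ := dom (t + 1)
    refine tendsto_integral_filter_of_dominated_convergence g (Eventually.of_forall ms) ?_ hg (ae_of_all _ fun s => ?_)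
    · filter_upwards [nhdsWithin_le_nhds (Iio_mem_nhds (show t < t + 1 by linarith))] with r hr
      exact h r (le_of_lt hr)
    · refine Tendsto.mul_const _ ?_
      refine (k_rc K (t - s)).tendsto.comp ?_
      rw [tendsto_nhdsWithin_iff]
      refine ⟨((continuous_id.sub continuous_const).tendsto t).mono_left nhdsWithin_le_nhds, ?_⟩
      filter_upwards [self_mem_nhdsWithin] with r hr
      exact sub_le_sub_right hr s
  · obtain ⟨g, hg, h⟩ := dom t
    refine ⟨∫ s, (if s < t then k (t - s) else 0) * p s ∂m, ?_⟩
    refine tendsto_integral_filter_of_dominated_convergence g (Eventually.of_forall ms) ?_ hg (ae_of_all _ fun s => ?_)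
    · filter_upwards [self_mem_nhdsWithin] with r hr
      exact h r (le_of_lt hr)
    · refine Tendsto.mul_const _ ?_
      by_cases hs : s < t
      · simp only [hs, if_true]
        have h1 : ContinuousAt k (t - s) := K.cont.continuousAt (Ici_mem_nhds (by linarith))
        exact h1.tendsto.comp (((continuous_id.sub continuous_const).tendsto t).mono_left nhdsWithin_le_nhds)
      · simp only [hs, if_false]
        refine tendsto_const_nhds.congr' ?_
        filter_upwards [self_mem_nhdsWithin] with r hr
        have hr : r < t := hr
        exact (K.neg _ (by linarith)).symm

lemma lint_Iic {f : ℝ → ℝ} (hf : Nice f) (h0 : ∀ t < 0, f t = 0) (t : ℝ) :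
    ∫⁻ r in Iic t, ENNReal.ofReal (f r) = ENNReal.ofReal (∫ r in (0:ℝ)..t, f r) := by
  have hneg : ∫⁻ r in Iio 0, ENNReal.ofReal (f r) = 0 := by
    rw [setLIntegral_congr_fun measurableSet_Iio (g := fun _ => 0) (fun r hr => by simp [h0 r hr])]
    simp
  rcases le_or_gt 0 t with ht | ht
  · have h1 : ∫⁻ r in Ioc 0 t, ENNReal.ofReal (f r) = ENNReal.ofReal (∫ r in (0:ℝ)..t, f r) := by
      rw [intervalIntegral.integral_of_le ht, ofReal_integral_eq_lintegral_ofReal]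
      · exact (hf.ii 0 t).1
      · exact ae_of_all _ hf.nn
    rw [← h1, ← Iic_union_Ioc_eq_Iic ht, lintegral_union measurableSet_Ioc (by
      rw [disjoint_left]; intro x hx hx2; exact absurd hx2.1 (not_lt.2 hx)), ← Iio_union_right,
      lintegral_union (measurableSet_singleton _) (by simp)]
    simp [hneg]
  · have h2 : ∫ r in (0:ℝ)..t, f r = 0 := by
      rw [intervalIntegral.integral_symm, intervalIntegral.integral_of_le ht.le,
        integral_Ioc_eq_integral_Ioo, setIntegral_congr_fun measurableSet_Ioo (g := fun _ => 0) (fun r hr => h0 r hr.2)]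
      simp
    rw [h2, ENNReal.ofReal_zero]
    exact le_antisymm ((lintegral_mono_set (Iic_subset_Iio.2 ht)).trans hneg.le) zero_le

lemma exu (b c : ℝ) (hc : 0 < c) (ν : Measure ℝ) (W k : ℝ → ℝ) (K : Ker b c ν W k)
    (μ : Measure ℝ) [SigmaFinite μ] (hμ0 : μ (Set.Iio 0) = 0)
    (hμfin : ∀ t : ℝ, 0 ≤ t → μ (Set.Icc 0 t) ≠ ⊤) :
    ∃ U u : ℝ → ℝ, Nice U ∧ Nice u ∧ (∀ t < 0, u t = 0) ∧
      (∀ t, ContinuousWithinAt u (Ici t) t) ∧ (∀ t, ∃ l, Tendsto u (𝓝[<] t) (𝓝 l)) ∧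
      (∀ t, U t = 1 + ∫ r in (0:ℝ)..t, u r) ∧
      (∀ t, ENNReal.ofReal (u t) = ∫⁻ s, ENNReal.ofReal (k (t - s)) * ENNReal.ofReal (U s) ∂μ) := by
  have hae : ∀ᵐ s ∂μ, 0 ≤ s := by
    rw [ae_iff]; simp only [not_le]; exact hμ0
  obtain ⟨U, hU, hU1, hUe⟩ := exU b c hc ν W k K μ hμ0 hμfin
  obtain ⟨c1, c2, c3⟩ := conv_facts b c hc ν W k K μ hμ0 hμfin U hU.meas hU.nn
    (fun T => by obtain ⟨M, _, h⟩ := hU.bd T; exact ⟨M, fun t _ ht => h t ht⟩)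
  have nn : ∀ t s, 0 ≤ k (t - s) * U s := fun t s => mul_nonneg (K.nn _) (hU.nn _)
  have neg : ∀ t < 0, ∫ s, k (t - s) * U s ∂μ = 0 := by
    intro t ht
    rw [integral_congr_ae (g := fun _ => 0)]
    · simp
    · filter_upwards [hae] with s hs
      rw [K.neg _ (by linarith), zero_mul]
  have e1 : ∀ t, ENNReal.ofReal (∫ s, k (t - s) * U s ∂μ) = ∫⁻ s, ENNReal.ofReal (k (t - s)) * ENNReal.ofReal (U s) ∂μ := by
    intro t
    rw [ofReal_integral_eq_lintegral_ofReal (c1 t) (ae_of_all _ (nn t))]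
    refine lintegral_congr fun s => ?_
    rw [ENNReal.ofReal_mul (K.nn _)]
  have hu : Nice fun t => ∫ s, k (t - s) * U s ∂μ := by
    refine ⟨meas_of_rc _ c2, fun t => integral_nonneg (nn t), fun T => ?_⟩
    obtain ⟨M, hM, h⟩ := hU.bd (max T 0)
    refine ⟨1 + (μ (Icc 0 (max T 0))).toReal * (1 / c * M), ?_, fun t ht => ?_⟩
    · have : 0 ≤ (μ (Icc 0 (max T 0))).toReal * (1 / c * M) := by positivity
      linarith
    · have hi : Integrable ((Icc 0 (max T 0)).indicator fun _ => 1 / c * M) μ := by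
        rw [integrable_indicator_iff measurableSet_Icc]
        exact integrableOn_const (hμfin _ (le_max_right _ _))
      have : ∫ s, k (t - s) * U s ∂μ ≤ ∫ s, (Icc 0 (max T 0)).indicator (fun _ => 1 / c * M) s ∂μ := by
        refine integral_mono_ae (c1 t) hi ?_
        filter_upwards [hae] with s hs
        by_cases hst : s ≤ t
        · have h1 : s ≤ max T 0 := (hst.trans ht).trans (le_max_left _ _)
          rw [indicator_of_mem (show s ∈ Icc 0 (max T 0) from ⟨hs, h1⟩)]
          exact mul_le_mul (K.le _) (h s h1) (hU.nn s) (by positivity)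
        · rw [K.neg _ (by linarith), zero_mul]
          exact indicator_nonneg (fun x hx => by positivity) s
      rw [integral_indicator_const _ measurableSet_Icc] at this
      simp only [Measure.real, smul_eq_mul] at this
      linarith
  refine ⟨U, fun t => ∫ s, k (t - s) * U s ∂μ, hU, hu, neg, c2, c3, fun t => ?_, e1⟩
  have hk : Measurable fun x => ENNReal.ofReal (k x) := K.meas.ennreal_ofReal
  have hI : 0 ≤ ∫ r in (0:ℝ)..t, ∫ s, k (r - s) * U s ∂μ := by
    rcases le_or_gt 0 t with ht | ht
    · exact intervalIntegral.integral_nonneg ht fun x _ => hu.nn x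
    · rw [intervalIntegral.integral_symm, intervalIntegral.integral_of_le ht.le,
        integral_Ioc_eq_integral_Ioo, setIntegral_congr_fun measurableSet_Ioo (g := fun _ => 0) (fun r hr => neg r hr.2)]
      simp
  rw [← ENNReal.ofReal_eq_ofReal_iff (hU.nn t) (by linarith), ENNReal.ofReal_add zero_le_one hI, ← lint_Iic hu neg, hUe,
    ENNReal.ofReal_one]
  congr 1
  simp only [e1]
  rw [lintegral_lintegral_swap]
  · refine lintegral_congr fun s => ?_
    have hm : Measurable fun x => ENNReal.ofReal (k (x - s)) := hk.comp (measurable_id.sub_const s)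
    rw [lintegral_mul_const _ hm, K.prim]
    congr 1
    rw [← lintegral_indicator measurableSet_Iic, ← lintegral_indicator measurableSet_Iic, ← lintegral_sub_right_eq_self _ s]
    refine lintegral_congr fun r => ?_
    simp only [indicator, mem_Iic, sub_le_sub_iff_right]
  · refine Measurable.aemeasurable ?_
    exact (hk.comp (measurable_fst.sub measurable_snd)).mul (hU.meas.ennreal_ofReal.comp measurable_snd)

/-- `h` is a primitive of the right-derivative `h'` -/
structure RD (h h' : ℝ → ℝ) : Prop where
  cont : Continuous h
  der : ∀ x, HasDerivWithinAt h (h' x) (Ioi x) x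
  ii : ∀ a b, IntervalIntegrable h' volume a b

lemma RD.int {h h' : ℝ → ℝ} (H : RD h h') (a b : ℝ) : ∫ x in a..b, h' x = h b - h a :=
  intervalIntegral.integral_eq_sub_of_hasDeriv_right H.cont.continuousOn (fun x _ => H.der x) (H.ii a b)

lemma RD.ibp {p p' q q' : ℝ → ℝ} (P : RD p p') (Q : RD q q') (a b : ℝ) :
    ∫ x in a..b, p x * q' x = p b * q b - p a * q a - ∫ x in a..b, p' x * q x :=
  intervalIntegral.integral_mul_deriv_eq_deriv_mul_of_hasDeriv_right P.cont.continuousOn Q.cont.continuousOn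
    (fun x _ => P.der x) (fun x _ => Q.der x) (P.ii a b) (Q.ii a b)

lemma RD.prim {f : ℝ → ℝ} (hm : Measurable f) (hi : ∀ a b, IntervalIntegrable f volume a b)
    (hr : ∀ t, ContinuousWithinAt f (Ici t) t) : RD (fun t => ∫ r in (0:ℝ)..t, f r) f := by
  refine ⟨intervalIntegral.continuous_primitive hi 0, fun x => ?_, hi⟩
  have : HasDerivWithinAt (fun t => ∫ r in (0:ℝ)..t, f r) (f x) (Ici x) x :=
    intervalIntegral.integral_hasDerivWithinAt_right (hi 0 x) (s := Ici x) (t := Ioi x)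
    (hm.stronglyMeasurable.stronglyMeasurableAtFilter) ((hr x).mono Ioi_subset_Ici_self)
  exact this.mono Ioi_subset_Ici_self

structure Good (f : ℝ → ℝ) : Prop where
  nice : Nice f
  neg : ∀ t < 0, f t = 0
  rc : ∀ t, ContinuousWithinAt f (Ici t) t

lemma Good.rd {f : ℝ → ℝ} (h : Good f) : RD (fun t => ∫ r in (0:ℝ)..t, f r) f :=
  RD.prim h.nice.meas h.nice.ii h.rc

lemma Good.prim_neg {f : ℝ → ℝ} (h : Good f) (t : ℝ) (ht : t ≤ 0) : ∫ r in (0:ℝ)..t, f r = 0 := by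
  rw [intervalIntegral.integral_symm, intervalIntegral.integral_of_le ht,
    integral_Ioc_eq_integral_Ioo, setIntegral_congr_fun measurableSet_Ioo (g := fun _ => 0) (fun r hr => h.neg r hr.2)]
  simp

lemma Good.prim_nn {f : ℝ → ℝ} (h : Good f) (t : ℝ) : 0 ≤ ∫ r in (0:ℝ)..t, f r := by
  rcases le_total 0 t with ht | ht
  · exact intervalIntegral.integral_nonneg ht fun x _ => h.nice.nn x
  · rw [h.prim_neg t ht]

lemma Good.L_cont {f : ℝ → ℝ} (h : Good f) (y : ℝ) : Continuous fun s => ∫ r in (max (s - y) 0)..s, f r :=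
  h.nice.F_meas.comp (Continuous.prodMk_left y)

lemma Good.L_eq {f : ℝ → ℝ} (h : Good f) (y s : ℝ) : ∫ r in (max (s - y) 0)..s, f r =
    (∫ r in (0:ℝ)..s, f r) - ∫ r in (0:ℝ)..(s - y), f r := by
  rw [← intervalIntegral.integral_interval_sub_left (h.nice.ii 0 s) (h.nice.ii 0 (max (s - y) 0))]
  rcases le_total (s - y) 0 with h1 | h1
  · rw [max_eq_right h1, h.prim_neg _ h1]; simp
  · rw [max_eq_left h1]

/-- the derivative of the triangle convolution -/
noncomputable def tri' (f : ℝ → ℝ) (y s : ℝ) : ℝ := y * f s - ∫ r in (max (s - y) 0)..s, f r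

lemma Good.tri_rd {f : ℝ → ℝ} (h : Good f) (y : ℝ) : RD (fun t => ∫ s in (0:ℝ)..t, tri' f y s) (tri' f y) := by
  have hc := h.L_cont y
  have hm := h.nice.meas
  refine RD.prim (f := tri' f y) ?_ (fun a b => ?_) fun t => ?_
  · exact (hm.const_mul y).sub hc.measurable
  · exact ((h.nice.ii a b).const_mul y).sub (hc.intervalIntegrable a b)
  · exact (continuousWithinAt_const.mul (h.rc t)).sub hc.continuousWithinAt

lemma Good.tri_eq {f : ℝ → ℝ} (h : Good f) (y : ℝ) (hy : 0 < y) (t : ℝ) (ht : 0 ≤ t) :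
    ∫ s in (0:ℝ)..t, tri' f y s = ∫ s in (max (t - y) 0)..t, (y - (t - s)) * f s := by
  have hF := h.rd
  set F := fun t => ∫ r in (0:ℝ)..t, f r with hFd
  have hp : RD (fun s => y - (t - s)) (fun _ => 1) :=
    ⟨by fun_prop, fun x => by
      simpa using (((hasDerivAt_id x).const_sub t).const_sub y).hasDerivWithinAt, fun a b => by simp⟩
  have e1 := hp.ibp hF (max (t - y) 0) t
  rw [e1]
  have e2 : (y - (t - max (t - y) 0)) * F (max (t - y) 0) = 0 := by
    rcases le_total (t - y) 0 with h1 | h1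
    · rw [max_eq_right h1]; simp [F]
    · rw [max_eq_left h1]; simp
  rw [e2]
  simp only [tri', one_mul, h.L_eq]
  have hFc := hF.cont
  have hFi : ∀ a b, IntervalIntegrable F volume a b := fun a b => hFc.intervalIntegrable a b
  have hFci : ∀ a b, IntervalIntegrable (fun s => F (s - y)) volume a b := fun a b =>
    (hFc.comp (continuous_id.sub continuous_const)).intervalIntegrable a b
  change ∫ s in (0:ℝ)..t, (y * f s - (F s - F (s - y))) = _
  rw [intervalIntegral.integral_sub ((h.nice.ii 0 t).const_mul y) ((hFi 0 t).sub (hFci 0 t)),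
    intervalIntegral.integral_sub (hFi 0 t) (hFci 0 t), intervalIntegral.integral_const_mul,
    intervalIntegral.integral_comp_sub_right (fun s => F s) y]
  have e3 : ∫ s in (0 - y)..(t - y), F s = ∫ s in (0:ℝ)..(max (t - y) 0), F s := by
    have z : ∀ a b, a ≤ 0 → b ≤ 0 → ∫ s in a..b, F s = 0 := by
      intro a b ha hb
      rw [intervalIntegral.integral_congr (g := fun _ => 0)]
      · simp
      · intro x hx
        exact h.prim_neg x (hx.2.trans (max_le ha hb))
    rw [← intervalIntegral.integral_add_adjacent_intervals (hFi (0 - y) 0) (hFi 0 (t - y)), z _ _ (by linarith) le_rfl, zero_add]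
    rcases le_total (t - y) 0 with h1 | h1
    · rw [max_eq_right h1, z _ _ le_rfl h1]; simp
    · rw [max_eq_left h1]
  rw [e3, ← intervalIntegral.integral_add_adjacent_intervals (hFi 0 (max (t - y) 0)) (hFi _ t)]
  simp only [F, sub_sub_cancel]
  ring

lemma Good.tri_nn {f : ℝ → ℝ} (h : Good f) (y : ℝ) (hy : 0 < y) (t : ℝ) (ht : 0 ≤ t) :
    0 ≤ ∫ s in (0:ℝ)..t, tri' f y s := by
  rw [h.tri_eq y hy t ht]
  refine intervalIntegral.integral_nonneg (max_le (by linarith) ht) fun x hx => ?_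
  have := (le_max_left (t - y) 0).trans hx.1
  exact mul_nonneg (by linarith) (h.nice.nn x)

lemma Good.tri_lint {f : ℝ → ℝ} (h : Good f) (y : ℝ) (hy : 0 < y) (t : ℝ) (ht : 0 ≤ t) :
    ∫⁻ s in Iic t, ENNReal.ofReal (y - (t - s)) * ENNReal.ofReal (f s) = ENNReal.ofReal (∫ s in (0:ℝ)..t, tri' f y s) := by
  rw [h.tri_eq y hy t ht, intervalIntegral.integral_of_le (max_le (by linarith) ht), ofReal_integral_eq_lintegral_ofReal]
  · rw [← lintegral_indicator measurableSet_Iic, ← lintegral_indicator measurableSet_Ioc]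
    have : ∀ᵐ s : ℝ, s ≠ 0 := by simp [ae_iff]
    refine lintegral_congr_ae ?_
    filter_upwards [this] with s hs0
    simp only [indicator, mem_Iic, mem_Ioc]
    by_cases h1 : s ≤ t
    · simp only [h1, and_true, if_true]
      split_ifs with h2
      · have := (le_max_left (t - y) 0).trans h2.le
        rw [ENNReal.ofReal_mul (by linarith)]
      · rw [not_lt, le_max_iff] at h2
        rcases h2 with h2 | h2
        · rw [ENNReal.ofReal_of_nonpos (by linarith), zero_mul]
        · rw [h.neg s (lt_of_le_of_ne h2 hs0)]; simp
    · simp [h1]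
  · exact ((h.nice.ii _ t).continuousOn_mul (by fun_prop : ContinuousOn (fun s => y - (t - s)) _)).1
  · filter_upwards [ae_restrict_mem measurableSet_Ioc] with x hx
    have := (le_max_left (t - y) 0).trans hx.1.le
    exact mul_nonneg (by linarith) (h.nice.nn x)

structure Sys (U u V : ℝ → ℝ) : Prop where
  good : Good u
  ll : ∀ t, ∃ l, Tendsto u (𝓝[<] t) (𝓝 l)
  hU : ∀ t, U t = 1 + ∫ r in (0:ℝ)..t, u r
  hV : ∀ t, V t = u t / U t

namespace Sys
variable {U u V : ℝ → ℝ}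

lemma U1 (S : Sys U u V) (t : ℝ) : 1 ≤ U t := by
  rw [S.hU]; linarith [S.good.prim_nn t]

lemma Upos (S : Sys U u V) (t : ℝ) : 0 < U t := by linarith [S.U1 t]

lemma Urd (S : Sys U u V) : RD U u := by
  have h := S.good.rd
  have : U = fun t => 1 + ∫ r in (0:ℝ)..t, u r := funext S.hU
  rw [this]
  exact ⟨continuous_const.add h.cont, fun x => (h.der x).const_add 1, h.ii⟩

lemma Vgood (S : Sys U u V) : Good V := by
  have hc := S.Urd.cont
  have : V = fun t => u t / U t := funext S.hV
  refine ⟨⟨?_, fun t => ?_, fun T => ?_⟩, fun t ht => ?_, fun t => ?_⟩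
  · rw [this]; exact S.good.nice.meas.div hc.measurable
  · rw [S.hV]; exact div_nonneg (S.good.nice.nn t) (S.Upos t).le
  · obtain ⟨M, h1, h⟩ := S.good.nice.bd T
    refine ⟨M, h1, fun t ht => ?_⟩
    rw [S.hV]
    exact (div_le_self (S.good.nice.nn t) (S.U1 t)).trans (h t ht)
  · rw [S.hV, S.good.neg t ht, zero_div]
  · rw [this]
    exact (S.good.rc t).div hc.continuousWithinAt (S.Upos t).ne'

lemma Vll (S : Sys U u V) (t : ℝ) : ∃ l, Tendsto V (𝓝[<] t) (𝓝 l) := by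
  obtain ⟨l, hl⟩ := S.ll t
  have : V = fun t => u t / U t := funext S.hV
  rw [this]
  exact ⟨_, hl.div (S.Urd.cont.continuousAt.tendsto.mono_left nhdsWithin_le_nhds) (S.Upos t).ne'⟩

lemma logrd (S : Sys U u V) : RD (fun t => Real.log (U t)) V := by
  refine ⟨S.Urd.cont.log fun t => (S.Upos t).ne', fun x => ?_, S.Vgood.nice.ii⟩
  rw [S.hV]
  exact (S.Urd.der x).log (S.Upos x).ne'

lemma invrd (S : Sys U u V) : RD (fun t => (U t)⁻¹) (fun t => -(V t / U t)) := by
  refine ⟨S.Urd.cont.inv₀ fun t => (S.Upos t).ne', fun x => ?_, fun a b => ?_⟩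
  · have := (S.Urd.der x).inv (S.Upos x).ne'
    have e : -(V x / U x) = -u x / U x ^ 2 := by
      rw [S.hV]; have := S.Upos x; field_simp
    rw [e]; exact this
  · have h1 : Continuous fun t => -(U t)⁻¹ := (S.Urd.cont.inv₀ fun t => (S.Upos t).ne').neg
    refine ((S.Vgood.nice.ii a b).mul_continuousOn h1.continuousOn).congr_ae ?_
    refine ae_of_all _ fun x => ?_
    simp only [div_eq_mul_inv, mul_neg]

lemma exp_eq (S : Sys U u V) (a b : ℝ) : Real.exp (-∫ r in a..b, V r) = U a / U b := by
  rw [S.logrd.int, neg_sub, Real.exp_sub, Real.exp_log (S.Upos a), Real.exp_log (S.Upos b)]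

lemma lemB (S : Sys U u V) {h h' : ℝ → ℝ} (H : RD h h') (h0 : h 0 = 0) (t : ℝ) :
    h t / U t + ∫ r in (0:ℝ)..t, h r * (V r / U r) = ∫ r in (0:ℝ)..t, h' r / U r := by
  have := S.invrd.ibp H 0 t
  rw [h0, mul_zero, sub_zero] at this
  have e1 : ∫ r in (0:ℝ)..t, h' r / U r = ∫ r in (0:ℝ)..t, (U r)⁻¹ * h' r := by
    congr 1; ext r; rw [div_eq_inv_mul]
  have e2 : ∫ r in (0:ℝ)..t, -(V r / U r) * h r = -∫ r in (0:ℝ)..t, h r * (V r / U r) := by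
    rw [← intervalIntegral.integral_neg]; congr 1; ext r; ring
  rw [e1, this, e2]
  rw [div_eq_inv_mul]; ring

lemma tri_key (S : Sys U u V) (y t : ℝ) :
    (∫ s in (0:ℝ)..t, tri' u y s) / U t + ∫ r in (0:ℝ)..t, (∫ s in (0:ℝ)..r, tri' u y s) * (V r / U r) =
    (∫ s in (0:ℝ)..t, tri' V y s) + ∫ s in (0:ℝ)..t, ph (∫ r in (max (s - y) 0)..s, V r) := by
  rw [S.lemB (S.good.tri_rd y) (by simp), ← intervalIntegral.integral_add]
  · congr 1; ext s
    have h1 : ∫ r in (max (s - y) 0)..s, u r = U s - U (max (s - y) 0) := by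
      rw [S.Urd.int]
    simp only [tri', ph, S.exp_eq, h1, S.hV s]
    have := S.Upos s
    field_simp
    ring
  · exact (S.Vgood.tri_rd y).ii 0 t
  · have : Continuous ph := by unfold ph; fun_prop
    exact (this.comp (S.Vgood.L_cont y)).intervalIntegrable 0 t

lemma b_key (S : Sys U u V) (t : ℝ) :
    (∫ s in (0:ℝ)..t, u s) / U t + ∫ r in (0:ℝ)..t, (∫ s in (0:ℝ)..r, u s) * (V r / U r) =
    ∫ s in (0:ℝ)..t, V s := by
  rw [S.lemB S.good.rd (by simp)]
  congr 1; ext s; rw [S.hV]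

end Sys

noncomputable def TT (U V : ℝ → ℝ) (G : ℝ → ℝ≥0∞) (t : ℝ) : ℝ≥0∞ :=
  G t * ENNReal.ofReal (U t)⁻¹ + ∫⁻ r in Ioc 0 t, G r * ENNReal.ofReal (V r / U r)

noncomputable def DD (f : ℝ → ℝ) (r y : ℝ) : ℝ≥0∞ :=
  ∫⁻ s in Iic r, ENNReal.ofReal (y - (r - s)) * ENNReal.ofReal (f s)

lemma DD_meas {f : ℝ → ℝ} (hf : Measurable f) : Measurable fun p : ℝ × ℝ => DD f p.1 p.2 := by
  have : (fun p : ℝ × ℝ => DD f p.1 p.2) = fun p : ℝ × ℝ => ∫⁻ s, {q : (ℝ × ℝ) × ℝ | q.2 ≤ q.1.1}.indicator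
      (fun q => ENNReal.ofReal (q.1.2 - (q.1.1 - q.2)) * ENNReal.ofReal (f q.2)) (p, s) := by
    ext p
    rw [DD, ← lintegral_indicator measurableSet_Iic]
    rfl
  rw [this]
  refine Measurable.lintegral_prod_right' (f := fun q : (ℝ × ℝ) × ℝ => {q : (ℝ × ℝ) × ℝ | q.2 ≤ q.1.1}.indicator
      (fun q => ENNReal.ofReal (q.1.2 - (q.1.1 - q.2)) * ENNReal.ofReal (f q.2)) q) ?_
  refine Measurable.indicator (by fun_prop) (measurableSet_le (by fun_prop) (by fun_prop))

lemma kap_conv (b : ℝ) (ν : Measure ℝ) (hs : SFinite (ν.restrict (Ioi 0))) {f : ℝ → ℝ} (hf : Measurable f) (t : ℝ) :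
    ∫⁻ s, kap b ν (t - s) * ENNReal.ofReal (f s) =
      ENNReal.ofReal b * (∫⁻ s in Iic t, ENNReal.ofReal (f s)) + ∫⁻ y in Ioi 0, DD f t y ∂ν := by
  have hf' := hf.ennreal_ofReal
  have e1 : ∀ s, kap b ν (t - s) * ENNReal.ofReal (f s) = (Iic t).indicator (fun s =>
      ENNReal.ofReal b * ENNReal.ofReal (f s) + ∫⁻ y in Ioi 0, ENNReal.ofReal (y - (t - s)) * ENNReal.ofReal (f s) ∂ν) s := by
    intro s
    by_cases h : s ≤ t
    · rw [indicator_of_mem (show s ∈ Iic t from h), kap, indicator_of_mem (show t - s ∈ Ici 0 by simpa using h), add_mul,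
        lintegral_mul_const _ (by fun_prop)]
    · rw [indicator_of_notMem (show s ∉ Iic t from h), kap, indicator_of_notMem (show t - s ∉ Ici 0 by simpa using h), zero_mul]
  simp only [e1]
  rw [lintegral_indicator measurableSet_Iic, lintegral_add_left (by fun_prop), lintegral_const_mul _ hf']
  congr 1
  rw [lintegral_lintegral_swap]
  · rfl
  · exact Measurable.aemeasurable (by fun_prop)

namespace Sys
variable {U u V : ℝ → ℝ}

lemma T_congr (t : ℝ) (G G' : ℝ → ℝ≥0∞) (h1 : G t = G' t) (h2 : ∀ᵐ r, 0 < r → r ≤ t → G r = G' r) :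
    TT U V G t = TT U V G' t := by
  rw [TT, TT, h1]
  congr 1
  refine lintegral_congr_ae ?_
  rw [EventuallyEq, ae_restrict_iff' measurableSet_Ioc]
  filter_upwards [h2] with r hr hrt
  rw [hr hrt.1 hrt.2]

lemma T_add (S : Sys U u V) (t : ℝ) (G G' : ℝ → ℝ≥0∞) (hG : Measurable G) :
    TT U V (fun r => G r + G' r) t = TT U V G t + TT U V G' t := by
  have := S.Vgood.nice.meas
  have := S.Urd.cont.measurable
  simp only [TT, add_mul]
  rw [lintegral_add_left (by fun_prop), add_add_add_comm]

lemma T_mul (t : ℝ) (a : ℝ≥0∞) (ha : a ≠ ⊤) (G : ℝ → ℝ≥0∞) :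
    TT U V (fun r => a * G r) t = a * TT U V G t := by
  simp only [TT, mul_assoc]
  rw [lintegral_const_mul' _ _ ha, mul_add]

lemma T_lint (S : Sys U u V) (t : ℝ) (ρ : Measure ℝ) [SFinite ρ] (G : ℝ → ℝ → ℝ≥0∞) (hG : Measurable fun p : ℝ × ℝ => G p.1 p.2) :
    TT U V (fun r => ∫⁻ y, G r y ∂ρ) t = ∫⁻ y, TT U V (fun r => G r y) t ∂ρ := by
  have hV := S.Vgood.nice.meas
  have hU := S.Urd.cont.measurable
  have h1 : ∀ r, Measurable (G r) := fun r => hG.comp measurable_prodMk_left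
  simp only [TT]
  rw [lintegral_add_left ((h1 t).mul_const _), lintegral_mul_const _ (h1 t)]
  congr 1
  rw [← lintegral_lintegral_swap]
  · refine lintegral_congr fun r => ?_
    rw [lintegral_mul_const _ (h1 r)]
  · refine Measurable.aemeasurable ?_
    exact hG.mul (by fun_prop)

lemma T_ofReal (S : Sys U u V) (t : ℝ) (ht : 0 ≤ t) (h : ℝ → ℝ) (hc : Continuous h) (hn : ∀ r, 0 ≤ r → 0 ≤ h r) :
    TT U V (fun r => ENNReal.ofReal (h r)) t = ENNReal.ofReal (h t / U t + ∫ r in (0:ℝ)..t, h r * (V r / U r)) := by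
  have hV := S.Vgood.nice
  have hq : ∀ r, 0 ≤ V r / U r := fun r => div_nonneg (hV.nn r) (S.Upos r).le
  have h3 : ∀ r ∈ Icc 0 t, 0 ≤ h r * (V r / U r) := fun r hr => mul_nonneg (hn r hr.1) (hq r)
  rw [ENNReal.ofReal_add (div_nonneg (hn t ht) (S.Upos t).le) (intervalIntegral.integral_nonneg ht h3), TT,
    div_eq_mul_inv, ENNReal.ofReal_mul (hn t ht), intervalIntegral.integral_of_le ht, ofReal_integral_eq_lintegral_ofReal]
  · congr 1
    refine setLIntegral_congr_fun measurableSet_Ioc fun r hr => ?_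
    rw [ENNReal.ofReal_mul (hn r hr.1.le)]
  · have := ((S.invrd.ii 0 t).neg.continuousOn_mul hc.continuousOn).1
    simp only [Pi.neg_apply, neg_neg] at this
    exact this
  · filter_upwards [ae_restrict_mem measurableSet_Ioc] with x hx
    exact h3 x ⟨hx.1.le, hx.2⟩

lemma T_mu (S : Sys U u V) (μ : Measure ℝ) [SFinite μ] (hμ0 : μ (Set.Iio 0) = 0) (t : ℝ) :
    TT U V (fun r => (μ.withDensity fun s => ENNReal.ofReal (U s)) (Iic r)) t = μ (Iic t) := by
  have hae : ∀ᵐ s ∂μ, 0 ≤ s := by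
    rw [ae_iff]; simp only [not_le]; exact hμ0
  have hV := S.Vgood.nice
  have hVm := hV.meas
  have hU := S.Urd.cont.measurable
  have e1 : (fun r => (μ.withDensity fun s => ENNReal.ofReal (U s)) (Iic r)) = fun r => ∫⁻ s,
      {q : ℝ × ℝ | q.2 ≤ q.1}.indicator (fun q => ENNReal.ofReal (U q.2)) (r, s) ∂μ := by
    ext r
    rw [withDensity_apply _ measurableSet_Iic, ← lintegral_indicator measurableSet_Iic]
    rfl
  rw [e1, S.T_lint t μ (fun r s => {q : ℝ × ℝ | q.2 ≤ q.1}.indicator (fun q => ENNReal.ofReal (U q.2)) (r, s))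
    (Measurable.indicator (by fun_prop) (measurableSet_le (by fun_prop) (by fun_prop)))]
  rw [← lintegral_indicator_one measurableSet_Iic]
  refine lintegral_congr_ae ?_
  filter_upwards [hae] with s hs
  by_cases hst : s ≤ t
  · rw [indicator_of_mem (show s ∈ Iic t from hst)]
    have e2 : ∀ r, {q : ℝ × ℝ | q.2 ≤ q.1}.indicator (fun q => ENNReal.ofReal (U q.2)) (r, s) =
        ENNReal.ofReal (U s) * (Ici s).indicator 1 r := by
      intro r
      by_cases h : s ≤ r <;> simp [indicator, h]
    simp only [e2]
    rw [T_mul _ _ ENNReal.ofReal_ne_top, TT, indicator_of_mem (show t ∈ Ici s from hst)]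
    have hq : ∀ r, 0 ≤ V r / U r := fun r => div_nonneg (hV.nn r) (S.Upos r).le
    have e3 : ∫⁻ r in Ioc 0 t, (Ici s).indicator 1 r * ENNReal.ofReal (V r / U r) = ENNReal.ofReal (∫ r in s..t, V r / U r) := by
      rw [intervalIntegral.integral_of_le hst, ofReal_integral_eq_lintegral_ofReal]
      · rw [← lintegral_indicator measurableSet_Ioc, ← lintegral_indicator measurableSet_Ioc]
        have : ∀ᵐ r : ℝ, r ≠ s := by simp [ae_iff]
        refine lintegral_congr_ae ?_
        filter_upwards [this] with r hr
        simp only [indicator, mem_Ioc, mem_Ici, Pi.one_apply, ite_mul, one_mul, zero_mul]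
        by_cases h1 : s ≤ r
        · have h2 : s < r := lt_of_le_of_ne h1 hr.symm
          simp [h1, h2, hs.trans_lt h2]
        · simp [h1, not_lt.2 (not_le.1 h1).le]
      · have h9 : IntegrableOn (fun x => - -(V x / U x)) (Ioc s t) volume := (S.invrd.ii s t).neg.1
        simp only [neg_neg] at h9
        exact h9
      · exact ae_of_all _ hq
    have e4 : ∫ r in s..t, V r / U r = (U s)⁻¹ - (U t)⁻¹ := by
      have := S.invrd.int s t
      rw [intervalIntegral.integral_neg] at this
      linarith
    have p1 := S.Upos s
    have p2 := S.Upos t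
    rw [e3, Pi.one_apply, one_mul, ← ENNReal.ofReal_add (inv_nonneg.2 p2.le) (intervalIntegral.integral_nonneg hst fun r _ => hq r),
      ← ENNReal.ofReal_mul p1.le, e4]
    have : U s * ((U t)⁻¹ + ((U s)⁻¹ - (U t)⁻¹)) = 1 := by field_simp; ring
    rw [this, ENNReal.ofReal_one]; rfl
  · rw [indicator_of_notMem (show s ∉ Iic t from hst)]
    have e2 : ∀ r ≤ t, {q : ℝ × ℝ | q.2 ≤ q.1}.indicator (fun q => ENNReal.ofReal (U q.2)) (r, s) = 0 := by
      intro r hr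
      have : ¬ s ≤ r := by linarith
      simp [indicator, this]
    rw [T_congr t _ (fun _ => 0) (e2 t le_rfl) (ae_of_all _ fun r _ hr => e2 r hr)]
    simp [TT]

lemma star (S : Sys U u V) (b c : ℝ) (hb : 0 ≤ b) (hc : 0 < c) (ν : Measure ℝ)
    (hν : ∫⁻ y in Set.Ioi (0 : ℝ), ENNReal.ofReal (min y (y ^ 2)) ∂ν ≠ ⊤)
    (μ : Measure ℝ) [SFinite μ] (hμ0 : μ (Set.Iio 0) = 0)
    (hyp : ∀ᵐ r, ENNReal.ofReal c * ENNReal.ofReal (u r) + ∫⁻ s, kap b ν (r - s) * ENNReal.ofReal (u s) =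
      (μ.withDensity fun s => ENNReal.ofReal (U s)) (Iic r)) :
    ∀ᵐ t, 0 ≤ t → μ (Iic t) = (ENNReal.ofReal c * ENNReal.ofReal (V t) + ∫⁻ s, kap b ν (t - s) * ENNReal.ofReal (V s))
      + ∫⁻ r in Ioc 0 t, ENNReal.ofReal (Rop c ν V r) := by
  have hs := nu_sfin ν hν
  have hu := S.good.nice
  have hum := hu.meas
  have hV := S.Vgood.nice
  have hVm := hV.meas
  filter_upwards [hyp] with t h1 ht
  rw [← S.T_mu μ hμ0 t, ← T_congr t _ _ h1 (hyp.mono fun r hr _ _ => hr)]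
  simp only [kap_conv b ν hs hum, kap_conv b ν hs hVm, lint_Iic hu S.good.neg, lint_Iic hV S.Vgood.neg]
  have mP : Measurable fun t => ENNReal.ofReal (∫ r in (0:ℝ)..t, u r) := hu.prim_cont.measurable.ennreal_ofReal
  rw [S.T_add t _ _ (by fun_prop), S.T_add t _ _ (mP.const_mul _), T_mul t _ ENNReal.ofReal_ne_top, T_mul t _ ENNReal.ofReal_ne_top,
    S.T_ofReal t ht _ hu.prim_cont (fun r _ => S.good.prim_nn r), S.b_key,
    S.T_lint t (ν.restrict (Ioi 0)) (DD u) (DD_meas hum)]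
  have eV : TT U V (fun r => ENNReal.ofReal (u r)) t = ENNReal.ofReal (V t) + ∫⁻ r in Ioc 0 t, ENNReal.ofReal (V r ^ 2) := by
    rw [TT, ← ENNReal.ofReal_mul (hu.nn t), S.hV t, div_eq_mul_inv]
    congr 1
    refine lintegral_congr fun r => ?_
    rw [← ENNReal.ofReal_mul (hu.nn r), S.hV r]
    congr 1; have := S.Upos r; field_simp
  have eD : ∫⁻ y in Ioi 0, TT U V (fun r => DD u r y) t ∂ν = ∫⁻ y in Ioi 0, DD V t y ∂ν +
      ∫⁻ y in Ioi 0, (∫⁻ r in Ioc 0 t, ENNReal.ofReal (ph (∫ x in (max (r - y) 0)..r, V x))) ∂ν := by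
    have hD : Measurable fun y => DD V t y := (DD_meas hVm).comp measurable_prodMk_left
    rw [← lintegral_add_left hD]
    refine setLIntegral_congr_fun measurableSet_Ioi fun y hy => ?_
    have hy : 0 < y := hy
    rw [T_congr t (fun r => DD u r y) (fun r => ENNReal.ofReal (∫ s in (0:ℝ)..r, tri' u y s)) (S.good.tri_lint y hy t ht)
      (ae_of_all _ fun r hr _ => S.good.tri_lint y hy r hr.le), S.T_ofReal t ht _ (S.good.tri_rd y).cont
      (fun r hr => S.good.tri_nn y hy r hr), S.tri_key, ENNReal.ofReal_add (S.Vgood.tri_nn y hy t ht)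
      (intervalIntegral.integral_nonneg ht fun _ _ => ph_nonneg _), ← S.Vgood.tri_lint y hy t ht]
    congr 1
    have : Continuous ph := by unfold ph; fun_prop
    rw [intervalIntegral.integral_of_le ht, ofReal_integral_eq_lintegral_ofReal]
    · exact ((this.comp (S.Vgood.L_cont y)).intervalIntegrable 0 t).1
    · exact ae_of_all _ fun _ => ph_nonneg _
  have mph : Measurable fun p : ℝ × ℝ => ENNReal.ofReal (ph (∫ r in (max (p.1 - p.2) 0)..p.1, V r)) :=
    (ph_meas.comp hV.F_meas.measurable).ennreal_ofReal
  have eR : ∫⁻ r in Ioc 0 t, ENNReal.ofReal (Rop c ν V r) = ENNReal.ofReal c * (∫⁻ r in Ioc 0 t, ENNReal.ofReal (V r ^ 2)) +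
      ∫⁻ y in Ioi 0, (∫⁻ r in Ioc 0 t, ENNReal.ofReal (ph (∫ x in (max (r - y) 0)..r, V x))) ∂ν := by
    rw [← lintegral_lintegral_swap mph.aemeasurable, ← lintegral_const_mul _ (by fun_prop), ← lintegral_add_left (by fun_prop)]
    refine setLIntegral_congr_fun measurableSet_Ioc fun r hr => ?_
    rw [Rop_eq, ENNReal.ofReal_add (by positivity) (integral_nonneg fun _ => ph_nonneg _), ENNReal.ofReal_mul hc.le,
      ofReal_integral_eq_lintegral_ofReal (Rop_int ν hν hV r hr.1.le) (ae_of_all _ fun _ => ph_nonneg _)]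
  rw [eV, eD, eR]
  ring

end Sys

lemma I1_eq {b c : ℝ} {ν : Measure ℝ} {W k : ℝ → ℝ} (K : Ker b c ν W k)
    (μ : Measure ℝ) (hμ0 : μ (Set.Iio 0) = 0) (t : ℝ) :
    ∫ s in Icc 0 t, k (t - s) ∂μ = ∫ s, k (t - s) * 1 ∂μ := by
  have hae : ∀ᵐ s ∂μ, 0 ≤ s := by
    rw [ae_iff]; simp only [not_le]; exact hμ0
  rw [← integral_indicator measurableSet_Icc]
  refine integral_congr_ae ?_
  filter_upwards [hae] with s hs
  by_cases h : s ≤ t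
  · simp [hs, h]
  · simp [h, K.neg (t - s) (by linarith)]

lemma I2_eq {b c : ℝ} {ν : Measure ℝ} {W k : ℝ → ℝ} (K : Ker b c ν W k) (R : ℝ → ℝ) (t : ℝ) (ht : 0 ≤ t) :
    ∫ s in (0:ℝ)..t, R s * k (t - s) = ∫ s in Ici 0, k (t - s) * R s := by
  rw [intervalIntegral.integral_of_le ht, ← integral_Icc_eq_integral_Ioc, ← integral_indicator measurableSet_Icc,
    ← integral_indicator measurableSet_Ici]
  congr 1; ext s
  by_cases h0 : 0 ≤ s
  · by_cases h : s ≤ t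
    · simp [h0, h, mul_comm]
    · simp [h, h0, K.neg (t - s) (by linarith)]
  · simp [h0]

lemma sol_le {b c : ℝ} (hc : 0 < c) {ν : Measure ℝ} {W k : ℝ → ℝ} (K : Ker b c ν W k)
    (μ : Measure ℝ) (hμfin : ∀ t : ℝ, 0 ≤ t → μ (Set.Icc 0 t) ≠ ⊤) (V : ℝ → ℝ) (t : ℝ) (ht : 0 ≤ t)
    (hV : V t = volterraRHS c ν μ k V t) : V t ≤ (μ (Icc 0 t)).toReal / c := by
  rw [hV, volterraRHS]
  have h1 : 0 ≤ ∫ s in (0:ℝ)..t, Rop c ν V s * k (t - s) :=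
    intervalIntegral.integral_nonneg ht fun s _ => mul_nonneg (Rop_nn c hc ν V s) (K.nn _)
  have h2 : ∫ s in Icc 0 t, k (t - s) ∂μ ≤ ∫ s in Icc 0 t, 1 / c ∂μ := by
    refine integral_mono_of_nonneg (ae_of_all _ fun s => K.nn _) ?_ (ae_of_all _ fun s => K.le _)
    exact integrableOn_const (hμfin t ht)
  rw [setIntegral_const, Measure.real, smul_eq_mul, mul_one_div] at h2
  linarith

lemma exist (b c : ℝ) (hb : 0 ≤ b) (hc : 0 < c) (ν : Measure ℝ)
    (hν : ∫⁻ y in Set.Ioi (0 : ℝ), ENNReal.ofReal (min y (y ^ 2)) ∂ν ≠ ⊤) (W k : ℝ → ℝ) (K : Ker b c ν W k)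
    (μ : Measure ℝ) [SigmaFinite μ] (hμ0 : μ (Set.Iio 0) = 0)
    (hμfin : ∀ t : ℝ, 0 ≤ t → μ (Set.Icc 0 t) ≠ ⊤) :
    ∃ V : ℝ → ℝ, Good V ∧ (∀ t, ∃ l, Tendsto V (𝓝[<] t) (𝓝 l)) ∧
      ∀ t : ℝ, 0 ≤ t → V t = volterraRHS c ν μ k V t := by
  have hs := nu_sfin ν hν
  obtain ⟨U, u, hU, hu, uneg, urc, ull, Ue, ue⟩ := exu b c hc ν W k K μ hμ0 hμfin
  have S : Sys U u (fun t => u t / U t) := ⟨⟨hu, uneg, urc⟩, ull, Ue, fun _ => rfl⟩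
  generalize (fun t => u t / U t) = V at S
  have hV := S.Vgood
  have hk : Measurable fun x => ENNReal.ofReal (k x) := K.meas.ennreal_ofReal
  have hkm := K.meas
  have hUm := hU.meas.ennreal_ofReal
  have hum := hu.meas.ennreal_ofReal
  have hVm := hV.nice.meas.ennreal_ofReal
  have hkap := kap_meas b ν hs
  have mIic : ∀ A : Measure ℝ, Measurable fun t => A (Iic t) := fun A =>
    Monotone.measurable fun x y hxy => measure_mono (Iic_subset_Iic.2 hxy)
  set kk := volume.withDensity fun x => ENNReal.ofReal (k x) with hkk
  set J := Jm b c ν with hJ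
  have res : J.conv kk = ell := K.res
  have mJ : ∀ f : ℝ → ℝ≥0∞, Measurable f → Measurable (fun t => ENNReal.ofReal c * f t + ∫⁻ s, kap b ν (t - s) * f s) := by
    intro f hf
    refine (hf.const_mul _).add ?_
    exact Measurable.lintegral_prod_right' (f := fun p : ℝ × ℝ => kap b ν (p.1 - p.2) * f p.2) (by fun_prop)
  have hyp : ∀ᵐ r, ENNReal.ofReal c * ENNReal.ofReal (u r) + ∫⁻ s, kap b ν (r - s) * ENNReal.ofReal (u s) =
      (μ.withDensity fun s => ENNReal.ofReal (U s)) (Iic r) := by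
    set m := μ.withDensity fun s => ENNReal.ofReal (U s) with hm
    have e1 : kk.conv m = volume.withDensity fun t => ENNReal.ofReal (u t) := by
      rw [hkk, conv_wd m _ hk]
      congr 1; ext t
      rw [ue, hm, lintegral_withDensity_eq_lintegral_mul _ hUm (by fun_prop)]
      refine lintegral_congr fun s => ?_
      simp [mul_comm]
    have e2 : J.conv (kk.conv m) = ell.conv m := by rw [← Measure.conv_assoc, res]
    rw [e1, hJ, J_conv_wd b c ν hs _ hum, ell_conv] at e2
    exact ae_of_wd_eq _ _ (mJ _ hum) (mIic _) e2
  have star := S.star b c hb hc ν hν μ hμ0 hyp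
  set R := Rop c ν V with hR
  have hRm : Measurable R := Rop_meas c ν hs V hV.nice
  have hRn : ∀ s, 0 ≤ R s := Rop_nn c hc ν V
  set R0 : ℝ → ℝ≥0∞ := (Ici 0).indicator fun s => ENNReal.ofReal (R s) with hR0
  have hR0m : Measurable R0 := hRm.ennreal_ofReal.indicator measurableSet_Ici
  set A := volume.withDensity fun t => ENNReal.ofReal (V t) with hA
  set RR := volume.withDensity R0 with hRR
  have E1 : J.conv A + ell.conv RR = ell.conv μ := by
    rw [hJ, hA, J_conv_wd b c ν hs _ hVm, ell_conv, ell_conv, ← withDensity_add_left (mJ _ hVm)]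
    refine withDensity_congr_ae ?_
    filter_upwards [star] with t ht
    simp only [Pi.add_apply]
    rcases le_or_gt 0 t with h0 | h0
    · rw [ht h0, hRR, withDensity_apply _ measurableSet_Iic]
      congr 1
      rw [hR0, setLIntegral_indicator measurableSet_Ici, Ici_inter_Iic]
      exact setLIntegral_congr Ioc_ae_eq_Icc.symm
    · have z1 : μ (Iic t) = 0 := measure_mono_null (Iic_subset_Iio.2 h0) hμ0
      have z2 : RR (Iic t) = 0 := by
        rw [hRR, withDensity_apply _ measurableSet_Iic, hR0, setLIntegral_indicator measurableSet_Ici, Ici_inter_Iic, Icc_eq_empty (not_le.2 h0)]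
        simp
      have z3 : ∫⁻ s, kap b ν (t - s) * ENNReal.ofReal (V s) = 0 := by
        rw [lintegral_eq_zero_iff (by fun_prop)]
        refine ae_of_all _ fun s => ?_
        by_cases h : s ≤ t
        · simp [hV.neg s (by linarith)]
        · have : kap b ν (t - s) = 0 := by
            rw [kap, indicator_of_notMem]; simpa using h
          simp [this]
      rw [z1, z2, z3, hV.neg t h0]; simp
  have E2 : ell.conv (kk.conv μ) = ell.conv (A + kk.conv RR) := by
    have f1 : ∀ B : Measure ℝ, SFinite B → kk.conv (ell.conv B) = ell.conv (kk.conv B) := by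
      intro B hB
      rw [← Measure.conv_assoc, Measure.conv_comm kk ell, Measure.conv_assoc]
    have f2 : kk.conv (J.conv A) = ell.conv A := by
      rw [← Measure.conv_assoc, Measure.conv_comm kk J, res]
    rw [← f1 μ inferInstance, ← E1, Measure.conv_add, Measure.conv_add, f1 RR inferInstance, f2]
  have qle : ∀ t, ∫⁻ s, ENNReal.ofReal (k (t - s)) ∂μ ≤ ENNReal.ofReal (u t) := by
    intro t
    rw [ue]
    refine lintegral_mono fun s => ?_
    have : 1 ≤ ENNReal.ofReal (U s) := by rw [← ENNReal.ofReal_one]; exact ENNReal.ofReal_le_ofReal (S.U1 s)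
    exact le_mul_of_one_le_right' this
  have g1 : kk.conv μ = volume.withDensity fun t => ∫⁻ s, ENNReal.ofReal (k (t - s)) ∂μ := conv_wd μ _ hk
  have g2 : kk.conv RR = volume.withDensity fun t => ∫⁻ s in Ici 0, ENNReal.ofReal (k (t - s)) * ENNReal.ofReal (R s) := by
    rw [hkk, conv_wd RR _ hk]
    congr 1; ext t
    rw [hRR, lintegral_withDensity_eq_lintegral_mul _ hR0m (by fun_prop), ← lintegral_indicator measurableSet_Ici]
    refine lintegral_congr fun s => ?_
    by_cases h : 0 ≤ s <;> simp [R0, h, mul_comm]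
  have m2 : Measurable fun t => ∫⁻ s in Ici 0, ENNReal.ofReal (k (t - s)) * ENNReal.ofReal (R s) :=
    Measurable.lintegral_prod_right' (f := fun p : ℝ × ℝ => ENNReal.ofReal (k (p.1 - p.2)) * ENNReal.ofReal (R p.2))
      ((hk.comp (measurable_fst.sub measurable_snd)).mul (by fun_prop))
  have m1 : Measurable fun t => ∫⁻ s, ENNReal.ofReal (k (t - s)) ∂μ :=
    Measurable.lintegral_prod_right' (f := fun p : ℝ × ℝ => ENNReal.ofReal (k (p.1 - p.2)))
      (hk.comp (measurable_fst.sub measurable_snd))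
  have E3 : kk.conv μ = A + kk.conv RR := by
    refine ell_cancel _ _ ?_ ?_ ?_ E2
    · intro t
      rw [g1, withDensity_apply _ measurableSet_Iic]
      refine ((lintegral_mono qle).trans_lt ?_).ne
      rw [lint_Iic hu uneg]
      exact ENNReal.ofReal_lt_top
    · rw [g1, withDensity_apply _ measurableSet_Iio, setLIntegral_congr_fun (g := fun _ => 0) measurableSet_Iio]
      · simp
      · intro t ht
        have := qle t
        rw [uneg t ht] at this
        simpa using this
    · have z1 : ∀ t ∈ Iio (0:ℝ), ENNReal.ofReal (V t) = 0 := fun t ht => by simp [hV.neg t ht]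
      have z2 : ∀ t ∈ Iio (0:ℝ), ∫⁻ s in Ici 0, ENNReal.ofReal (k (t - s)) * ENNReal.ofReal (R s) = 0 := by
        intro t ht
        have ht : t < 0 := ht
        have : ∫⁻ s in Ici 0, ENNReal.ofReal (k (t - s)) * ENNReal.ofReal (R s) = ∫⁻ s in Ici (0:ℝ), (0:ℝ≥0∞) := by
          refine setLIntegral_congr_fun measurableSet_Ici fun s hs => ?_
          have hs : 0 ≤ s := hs
          simp [K.neg (t - s) (by linarith)]
        rw [this, lintegral_zero]
      rw [g2, hA, Measure.add_apply, withDensity_apply _ measurableSet_Iio, withDensity_apply _ measurableSet_Iio,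
        setLIntegral_congr_fun measurableSet_Iio z1, setLIntegral_congr_fun measurableSet_Iio z2]
      simp
  rw [g1, g2, hA, ← withDensity_add_left hVm] at E3
  have E4 := ae_of_wd_eq _ _ m1 (hVm.add m2) E3
  obtain ⟨p1, p2, -⟩ := conv_facts b c hc ν W k K μ hμ0 hμfin (fun _ => 1) measurable_const (fun _ => zero_le_one)
    (fun T => ⟨1, fun _ _ _ => le_rfl⟩)
  have rn : (volume.restrict (Ici (0:ℝ))) (Iio 0) = 0 := by
    rw [Measure.restrict_apply measurableSet_Iio, Iio_inter_Ici, Ico_self, measure_empty]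
  obtain ⟨q1, q2, -⟩ := conv_facts b c hc ν W k K (volume.restrict (Ici 0)) rn (fun t ht => by
    rw [Measure.restrict_apply measurableSet_Icc]
    exact ((measure_mono inter_subset_left).trans_lt measure_Icc_lt_top).ne) R hRm hRn
    (fun T => by obtain ⟨B, hB⟩ := Rop_bd c hc ν hν hV.nice T; exact ⟨B, hB⟩)
  have E5 : ∀ᵐ t : ℝ, 0 ≤ t → ∫ s, k (t - s) * 1 ∂μ = V t + ∫ s in Ici 0, k (t - s) * R s := by
    filter_upwards [E4] with t ht _
    have n1 : 0 ≤ ∫ s in Ici 0, k (t - s) * R s := integral_nonneg fun s => mul_nonneg (K.nn _) (hRn s)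
    have n2 : 0 ≤ ∫ s, k (t - s) * 1 ∂μ := integral_nonneg fun s => mul_nonneg (K.nn _) zero_le_one
    rw [← ENNReal.ofReal_eq_ofReal_iff n2 (add_nonneg (hV.nice.nn t) n1), ENNReal.ofReal_add (hV.nice.nn t) n1,
      ofReal_integral_eq_lintegral_ofReal (p1 t) (ae_of_all _ fun s => mul_nonneg (K.nn _) zero_le_one),
      ofReal_integral_eq_lintegral_ofReal (q1 t) (ae_of_all _ fun s => mul_nonneg (K.nn _) (hRn s))]
    simp only [mul_one, ENNReal.ofReal_mul (K.nn _)]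
    exact ht
  refine ⟨V, hV, S.Vll, fun t ht => ?_⟩
  have := rc_upgrade _ _ E5 t ht (p2 t) ((hV.rc t).add (q2 t))
  rw [volterraRHS, I1_eq K μ hμ0, I2_eq K _ t ht, this]
  simp [R]

/-- Theorem 1.7 (well-posedness part): the nonlinear Volterra equation has a unique
nonnegative càdlàg global solution, bounded by `μ([0,t])/c`. -/
theorem stmt19
    (b c : ℝ) (hb : 0 ≤ b) (hc : 0 < c)
    (ν : Measure ℝ) (hν0 : ν (Set.Iic 0) = 0)
    (hνint : ∫⁻ y in Set.Ioi (0 : ℝ), ENNReal.ofReal (min y (y ^ 2)) ∂ν ≠ ⊤)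
    (W W' : ℝ → ℝ)
    (hWneg : ∀ x : ℝ, x < 0 → W x = 0)
    (hWnonneg : ∀ x : ℝ, 0 ≤ W x)
    (hWcont : ContinuousOn W (Set.Ici 0))
    (hWmono : StrictMonoOn W (Set.Ici 0))
    (hWlap : ∀ l : ℝ, 0 < l →
      (∫ x in Set.Ioi (0 : ℝ), Real.exp (-l * x) * W x) = 1 / phi b c ν l)
    (hW'neg : ∀ x : ℝ, x < 0 → W' x = 0)
    (hW'zero : W' 0 = 1 / c)
    (hW'deriv : ∀ x : ℝ, 0 < x → HasDerivAt W (W' x) x)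
    (hW'cont : ContinuousOn W' (Set.Ici 0))
    (μ : Measure ℝ) [SigmaFinite μ] (hμ0 : μ (Set.Iio 0) = 0)
    (hμfin : ∀ t : ℝ, 0 ≤ t → μ (Set.Icc 0 t) ≠ ⊤)
    :
    ∃ V : ℝ → ℝ,
      (CadlagNonneg V ∧
        (∀ t : ℝ, 0 ≤ t → V t = volterraRHS c ν μ W' V t) ∧
        (∀ t : ℝ, 0 ≤ t → V t ≤ (μ (Set.Icc 0 t)).toReal / c)) ∧
      (∀ V₂ : ℝ → ℝ, CadlagNonneg V₂ →
        (∀ t : ℝ, 0 ≤ t → V₂ t = volterraRHS c ν μ W' V₂ t) →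
        ∀ t : ℝ, 0 ≤ t → V₂ t = V t) := by
  have K := ker_of b c hb hc ν hνint W W' hWneg hWnonneg hWcont hWmono hWlap hW'neg hW'zero hW'deriv hW'cont
  obtain ⟨V, hV, hll, he⟩ := exist b c hb hc ν hνint W W' K μ hμ0 hμfin
  refine ⟨V, ⟨⟨fun t _ => hV.nice.nn t, fun t _ => hV.rc t, fun t _ => hll t⟩, he,
    fun t ht => sol_le hc K μ hμfin V t ht (he t ht)⟩, ?_⟩
  intro V₂ h2 e2 t ht
  set f : ℝ → ℝ := (Ici 0).indicator V₂ with hf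
  have hfe : ∀ t, 0 ≤ t → f t = V₂ t := fun t ht => indicator_of_mem (show t ∈ Ici 0 from ht) _
  have hf0 : ∀ t < 0, f t = 0 := fun t ht => indicator_of_notMem (show t ∉ Ici 0 by simpa using ht) _
  have hrc : ∀ t, ContinuousWithinAt f (Ici t) t := by
    intro t
    rcases le_or_gt 0 t with h | h
    · exact (h2.2.1 t h).congr (fun x hx => hfe x (h.trans hx)) (hfe t h)
    · have : f =ᶠ[𝓝 t] fun _ => 0 := by
        filter_upwards [Iio_mem_nhds h] with x hx
        exact hf0 x hx
      exact (continuousAt_const.congr this.symm).continuousWithinAt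
  have ef : ∀ t : ℝ, 0 ≤ t → f t = volterraRHS c ν μ W' f t := by
    intro t ht
    rw [hfe t ht, e2 t ht, volterraRHS, volterraRHS]
    congr 1
    refine intervalIntegral.integral_congr fun s hs => ?_
    rw [uIcc_of_le ht] at hs
    beta_reduce
    rw [Rop_congr c ν f V₂ hfe s hs.1]
  have nf : Nice f := by
    refine ⟨meas_of_rc f hrc, fun t => ?_, fun T => ?_⟩
    · rcases le_or_gt 0 t with h | h
      · rw [hfe t h]; exact h2.1 t h
      · rw [hf0 t h]
    · have hM : 0 ≤ (μ (Icc 0 (max T 0))).toReal / c := by positivity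
      refine ⟨1 + (μ (Icc 0 (max T 0))).toReal / c, by linarith, fun t ht => ?_⟩
      rcases le_or_gt 0 t with h | h
      · have h3 := sol_le hc K μ hμfin f t h (ef t h)
        have h4 : (μ (Icc 0 t)).toReal / c ≤ (μ (Icc 0 (max T 0))).toReal / c := by
          refine div_le_div_of_nonneg_right ?_ hc.le
          exact ENNReal.toReal_mono (hμfin _ (le_max_right _ _)) (measure_mono (Icc_subset_Icc_right (ht.trans (le_max_left _ _))))
        linarith
      · rw [hf0 t h]; linarith
  rw [← hfe t ht]
  exact uniq b c hc ν hνint W W' K μ f V nf hV.nice ef he t ht
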